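/- arXiv:2510.26134 — 3 statements merged into one kernel-verified Lean document; each statement's English description precedes it below -/
import Mathlib

section
/- (Stanley's theorem.) For every finite poset P with n elements, every x ∈ P, and every integer k, one has ℙ(f(x) = k)² ≥ ℙ(f(x) = k−1) · ℙ(f(x) = k+1); that is, the sequence k ↦ ℙ(f(x) = k) is log-concave. -/
open Finset

section Defs
variable (α : Type*) [Fintype α] [PartialOrder α]

/-- Linear extensions of a finite poset `α` with `n` elements: order-preserving
bijections to `Fin n` (representing the target `{1,…,n}`). -/
def LinExt : Type _ :=
  {f : α ≃ Fin (Fintype.card α) // ∀ x y : α, x < y → f x < f y}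

instance : Finite (LinExt α) := by unfold LinExt; infer_instance

noncomputable instance : Fintype (LinExt α) := Fintype.ofFinite _

end Defs

section Defs2
variable {α : Type*} [Fintype α] [PartialOrder α]

/-- the uniform probability `ℙ(E)` of an event `E` on linear extensions -/
noncomputable def Pr (E : LinExt α → Prop) : ℝ :=
  (Nat.card {f : LinExt α // E f} : ℝ) / (Nat.card (LinExt α) : ℝ)

/-- the value `f(x) ∈ {1,…,n}` of a linear extension at `x` -/
def val (f : LinExt α) (x : α) : ℕ := (f.1 x : ℕ) + 1

/-- `ℙ(x ≺ y)`, the probability that `x` precedes `y` in a uniform linear extension -/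
noncomputable def prLT (x y : α) : ℝ := Pr (fun f => val f x < val f y)

/-- the expectation `𝔼 f(x)` for `f` uniform on `E(P)` -/
noncomputable def expec (x : α) : ℝ :=
  (∑ f : LinExt α, (val f x : ℝ)) / (Nat.card (LinExt α) : ℝ)

/-- the variance `Var(f(x))` for `f` uniform on `E(P)` -/
noncomputable def variance (x : α) : ℝ :=
  (∑ f : LinExt α, ((val f x : ℝ) - expec x) ^ 2) / (Nat.card (LinExt α) : ℝ)

/-- the standard deviation `σ(x)` of `f(x)` -/
noncomputable def sigma (x : α) : ℝ := Real.sqrt (variance x)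

/-- `π(x)`: the number of elements of the poset incomparable to `x` -/
noncomputable def piVal (x : α) : ℕ := Nat.card {y : α // ¬ x ≤ y ∧ ¬ y ≤ x}

/-- `q(x) = max_{k ∈ {1,…,n}} ℙ(f(x) = k)` -/
noncomputable def qVal (x : α) : ℝ :=
  ⨆ k : Fin (Fintype.card α), Pr (fun f => val f x = (k : ℕ) + 1)

end Defs2


section Spectral
variable {ι : Type*} [Fintype ι]

/-- A nonnegative connected symmetric matrix `A` with positive fixed vector `g` and `A ≤ A²` is
negative semidefinite on the orthogonal complement of `g`. -/
theorem dotProduct_mulVec_nonpos_of_fixed [DecidableEq ι] (A : Matrix ι ι ℝ) (hA : A.IsSymm)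
    (hnn : ∀ i j, 0 ≤ A i j) (g : ι → ℝ) (hg : ∀ i, 0 < g i) (hfix : A.mulVec g = g)
    (hconn : ∀ u : ι → ℝ, (∀ i j, A i j ≠ 0 → u i = u j) → ∀ i j, u i = u j)
    (hsq : ∀ v, v ⬝ᵥ A.mulVec v ≤ A.mulVec v ⬝ᵥ A.mulVec v)
    (v : ι → ℝ) (hv : v ⬝ᵥ g = 0) : v ⬝ᵥ A.mulVec v ≤ 0 := by
  have hH : A.IsHermitian := by
    rw [Matrix.IsHermitian, Matrix.conjTranspose_eq_transpose_of_trivial]; exact hA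
  -- an eigenvector with eigenvalue at least one is a multiple of `g`
  have key : ∀ (μ : ℝ) (b : ι → ℝ), A.mulVec b = μ • b → 1 ≤ μ → v ⬝ᵥ b = 0 := by
    intro μ b hb hμ
    have hfix' : ∀ i, ∑ j, A i j * g j = g i := fun i => congrFun hfix i
    have hb' : ∀ i, ∑ j, A i j * b j = μ * b i := fun i => congrFun hb i
    have hsymm : ∀ i j, A i j = A j i := fun i j => (congrFun (congrFun hA j) i)
    let u : ι → ℝ := fun i => b i / g i
    have hbu : ∀ i, b i = u i * g i := fun i => (div_mul_cancel₀ _ (hg i).ne').symm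
    have h1 : ∑ i, ∑ j, A i j * g i * g j * (u i - u j) ^ 2
        = 2 * ((1 - μ) * ∑ i, b i ^ 2) := by
      have e1 : ∑ i, ∑ j, A i j * g i * g j * (u i) ^ 2 = ∑ i, b i ^ 2 := by
        refine Finset.sum_congr rfl fun i _ => ?_
        calc _ = (∑ j, A i j * g j) * (g i * u i ^ 2) := by
              rw [Finset.sum_mul]; exact Finset.sum_congr rfl fun j _ => by ring
          _ = _ := by rw [hfix', hbu]; ring
      have e2 : ∑ i, ∑ j, A i j * g i * g j * (u j) ^ 2 = ∑ i, b i ^ 2 := by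
        rw [Finset.sum_comm, ← e1]
        refine Finset.sum_congr rfl fun i _ => Finset.sum_congr rfl fun j _ => ?_
        rw [hsymm j i]; ring
      have e3 : ∑ i, ∑ j, A i j * g i * g j * (u i * u j) = μ * ∑ i, b i ^ 2 := by
        rw [Finset.mul_sum]
        refine Finset.sum_congr rfl fun i _ => ?_
        calc _ = (∑ j, A i j * b j) * b i := by
              rw [Finset.sum_mul]
              exact Finset.sum_congr rfl fun j _ => by rw [hbu i, hbu j]; ring
          _ = _ := by rw [hb']; ring
      have : ∑ i, ∑ j, A i j * g i * g j * (u i - u j) ^ 2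
          = ∑ i, ∑ j, A i j * g i * g j * (u i) ^ 2 + ∑ i, ∑ j, A i j * g i * g j * (u j) ^ 2
            - 2 * ∑ i, ∑ j, A i j * g i * g j * (u i * u j) := by
        simp only [Finset.mul_sum, ← Finset.sum_add_distrib, ← Finset.sum_sub_distrib]
        exact Finset.sum_congr rfl fun i _ => Finset.sum_congr rfl fun j _ => by ring
      rw [this, e1, e2, e3]; ring
    have hnn' : ∀ i j, 0 ≤ A i j * g i * g j * (u i - u j) ^ 2 := fun i j =>
      mul_nonneg (mul_nonneg (mul_nonneg (hnn i j) (hg i).le) (hg j).le) (sq_nonneg _)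
    have h2 : ∑ i, ∑ j, A i j * g i * g j * (u i - u j) ^ 2 = 0 := by
      refine le_antisymm ?_ (Finset.sum_nonneg fun i _ => Finset.sum_nonneg fun j _ => hnn' i j)
      rw [h1]
      nlinarith [Finset.sum_nonneg fun i (_ : i ∈ Finset.univ) => sq_nonneg (b i)]
    have h3 : ∀ i j, u i = u j := by
      refine hconn u fun i j hij => ?_
      have h4 := (Finset.sum_eq_zero_iff_of_nonneg
        (fun i _ => Finset.sum_nonneg fun j _ => hnn' i j)).1 h2 i (Finset.mem_univ _)
      have h5 := (Finset.sum_eq_zero_iff_of_nonneg (fun j _ => hnn' i j)).1 h4 j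
        (Finset.mem_univ _)
      have h6 : A i j * g i * g j ≠ 0 := mul_ne_zero (mul_ne_zero hij (hg i).ne') (hg j).ne'
      have := (mul_eq_zero.1 h5).resolve_left h6
      exact sub_eq_zero.1 (pow_eq_zero_iff two_ne_zero |>.1 this)
    rcases isEmpty_or_nonempty ι with h | ⟨⟨i₀⟩⟩
    · simp [dotProduct]
    · have : b = u i₀ • g := by
        ext i; simp [hbu i, h3 i i₀]
      rw [this, dotProduct_smul, hv, smul_zero]
  let b : ι → ι → ℝ := fun j => (hH.eigenvectorBasis j).ofLp
  have hb : ∀ j, A.mulVec (b j) = hH.eigenvalues j • b j := hH.mulVec_eigenvectorBasis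
  have hbb : ∀ j, b j ⬝ᵥ b j = 1 := by
    intro j
    have := hH.eigenvectorBasis.orthonormal.1 j
    have h2 := real_inner_self_eq_norm_sq (hH.eigenvectorBasis j)
    rw [this, EuclideanSpace.inner_eq_star_dotProduct, star_trivial, one_pow] at h2
    exact h2
  have hexp : ∀ w : ι → ℝ, v ⬝ᵥ w = ∑ j, (v ⬝ᵥ b j) * (w ⬝ᵥ b j) := by
    intro w
    have := hH.eigenvectorBasis.sum_inner_mul_inner (WithLp.toLp 2 v) (WithLp.toLp 2 w)
    simp only [EuclideanSpace.inner_eq_star_dotProduct, star_trivial] at this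
    rw [dotProduct_comm v w, ← this]
    refine Finset.sum_congr rfl fun j _ => ?_
    rw [dotProduct_comm v (b j)]
  rw [hexp]
  refine Finset.sum_nonpos fun j _ => ?_
  have h1 : A.mulVec v ⬝ᵥ b j = hH.eigenvalues j * (v ⬝ᵥ b j) := by
    rw [dotProduct_comm, Matrix.dotProduct_mulVec, ← Matrix.mulVec_transpose, hA.eq, hb,
      smul_dotProduct, dotProduct_comm, smul_eq_mul]
  rw [h1]
  have h2 := hsq (b j)
  rw [hb, dotProduct_smul, smul_dotProduct, dotProduct_smul, hbb] at h2
  simp only [smul_eq_mul, mul_one] at h2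
  by_cases h3 : 1 ≤ hH.eigenvalues j
  · rw [key _ _ (hb j) h3]; simp
  · have : hH.eigenvalues j ≤ 0 := by nlinarith
    nlinarith [sq_nonneg (v ⬝ᵥ b j)]

/-- Local-to-global principle: a nonnegative connected symmetric matrix `M` whose square, weighted
by a positive vector `h`, dominates `M`, is negative semidefinite on the `M`-orthogonal complement
of `h`. -/
theorem dotProduct_mulVec_nonpos_of_weighted [DecidableEq ι] (M : Matrix ι ι ℝ) (hM : M.IsSymm)
    (hnn : ∀ i j, 0 ≤ M i j) (h : ι → ℝ) (hh : ∀ i, 0 < h i) (hMh : ∀ i, 0 < M.mulVec h i)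
    (hconn : ∀ u : ι → ℝ, (∀ i j, M i j ≠ 0 → u i = u j) → ∀ i j, u i = u j)
    (hsq : ∀ v, v ⬝ᵥ M.mulVec v ≤ ∑ i, h i * (M.mulVec v i) ^ 2 / M.mulVec h i)
    (v : ι → ℝ) (hv : v ⬝ᵥ M.mulVec h = 0) : v ⬝ᵥ M.mulVec v ≤ 0 := by
  let s : ι → ℝ := fun i => √(M.mulVec h i / h i)
  have hs : ∀ i, 0 < s i := fun i => Real.sqrt_pos.2 (div_pos (hMh i) (hh i))
  have hss : ∀ i, s i ^ 2 = M.mulVec h i / h i :=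
    fun i => Real.sq_sqrt (div_pos (hMh i) (hh i)).le
  let A : Matrix ι ι ℝ := Matrix.of fun i j => M i j / (s i * s j)
  have hA : ∀ w i, A.mulVec (fun j => s j * w j) i = M.mulVec w i / s i := by
    intro w i
    simp only [Matrix.mulVec, dotProduct, A, Matrix.of_apply, Finset.sum_div]
    refine Finset.sum_congr rfl fun j _ => ?_
    have := (hs i).ne'
    have := (hs j).ne'
    field_simp
  have hq : ∀ w, (fun j => s j * w j) ⬝ᵥ A.mulVec (fun j => s j * w j) = w ⬝ᵥ M.mulVec w := by
    intro w
    refine Finset.sum_congr rfl fun j _ => ?_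
    rw [hA]
    have := (hs j).ne'
    field_simp
  rw [← hq]
  refine dotProduct_mulVec_nonpos_of_fixed A ?_ ?_ (fun i => s i * h i)
    (fun i => mul_pos (hs i) (hh i)) ?_ ?_ ?_ _ ?_
  · ext i j
    simp only [Matrix.transpose_apply, A, Matrix.of_apply]
    rw [hM.apply, mul_comm]
  · exact fun i j => div_nonneg (hnn i j) (mul_pos (hs i) (hs j)).le
  · ext i
    rw [hA, div_eq_iff (hs i).ne']
    have := hss i
    rw [eq_div_iff (hh i).ne'] at this
    linarith
  · intro u hu
    refine hconn u fun i j hij => hu i j ?_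
    exact div_ne_zero hij (mul_pos (hs i) (hs j)).ne'
  · intro w
    have hw : w = fun j => s j * (w j / s j) := by
      ext j; rw [mul_div_cancel₀ _ (hs j).ne']
    rw [hw, hq]
    refine (hsq _).trans (le_of_eq ?_)
    refine Finset.sum_congr rfl fun j _ => ?_
    rw [hA, div_mul_div_comm, ← pow_two, ← pow_two, hss]
    have := (hMh j).ne'
    have := (hh j).ne'
    field_simp
  · rw [← hv]
    refine Finset.sum_congr rfl fun i _ => ?_
    have := hss i
    rw [eq_div_iff (hh i).ne'] at this
    rw [← this]; ring

end Spectral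

section Atlas
open scoped Classical
variable {β : Type*} [PartialOrder β]

/-- `Blocks i y`: the element `y` has to be removed before `i.1` can be removed from the bottom
(`i.2 = false`) or from the top (`i.2 = true`). -/
def Blocks (i : β × Bool) (y : β) : Prop := bif i.2 then i.1 < y else y < i.1

/-- The moves available in `S`: removing a minimal element from the bottom, or a maximal element
from the top. -/
noncomputable def avail (S : Finset β) : Finset (β × Bool) :=
  {i ∈ S ×ˢ Finset.univ | ∀ y ∈ S, ¬ Blocks i y}

theorem mem_avail {S : Finset β} {i : β × Bool} :
    i ∈ avail S ↔ i.1 ∈ S ∧ ∀ y ∈ S, ¬ Blocks i y := by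
  simp [avail]

theorem mem_avail_erase_of_mem {S : Finset β} {x : β} {j : β × Bool} (hj : j ∈ avail S)
    (hne : j.1 ≠ x) : j ∈ avail (S.erase x) := by
  rw [mem_avail] at *
  exact ⟨mem_erase.2 ⟨hne, hj.1⟩, fun y hy => hj.2 y (mem_of_mem_erase hy)⟩

theorem fst_ne_of_mem_avail_erase {S : Finset β} {x : β} {j : β × Bool}
    (hj : j ∈ avail (S.erase x)) : j.1 ≠ x :=
  (mem_erase.1 (mem_avail.1 hj).1).1

theorem blocks_of_mem_avail_erase {S : Finset β} {x : β} {j : β × Bool}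
    (hj : j ∈ avail (S.erase x)) (hj' : j ∉ avail S) : Blocks j x := by
  rw [mem_avail] at *
  by_contra h
  refine hj' ⟨mem_of_mem_erase hj.1, fun y hy => ?_⟩
  by_cases hyx : y = x
  · rwa [hyx]
  · exact hj.2 y (mem_erase.2 ⟨hyx, hy⟩)

theorem snd_eq_of_mem_avail_erase {S : Finset β} {i j : β × Bool} (hi : i ∈ avail S)
    (hj : j ∈ avail (S.erase i.1)) (hj' : j ∉ avail S) : j.2 = i.2 := by
  have h := blocks_of_mem_avail_erase hj hj'
  have h2 := (mem_avail.1 hi).2 j.1 (mem_of_mem_erase (mem_avail.1 hj).1)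
  obtain ⟨x, a⟩ := i
  obtain ⟨y, b⟩ := j
  cases a <;> cases b <;> simp_all [Blocks]

theorem mem_avail_of_erase_of_erase {S : Finset β} {x y : β} {j : β × Bool} (hxy : x ≠ y)
    (hx : j ∈ avail (S.erase x)) (hy : j ∈ avail (S.erase y)) : j ∈ avail S := by
  by_contra h
  have hb := blocks_of_mem_avail_erase hx h
  by_cases hxS : x ∈ S
  · exact (mem_avail.1 hy).2 x (mem_erase.2 ⟨hxy, hxS⟩) hb
  · rw [erase_eq_of_notMem hxS] at hx
    exact h hx

theorem exists_mem_avail {S : Finset β} (hS : S.Nonempty) (d : Bool) :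
    ∃ x, (x, d) ∈ avail S := by
  cases d
  · obtain ⟨x, hx⟩ := S.exists_minimal hS
    exact ⟨x, mem_avail.2 ⟨hx.1, fun y hy h => hx.not_lt hy h⟩⟩
  · obtain ⟨x, hx⟩ := S.exists_maximal hS
    exact ⟨x, mem_avail.2 ⟨hx.1, fun y hy h => hx.not_gt hy h⟩⟩

/-- Weighted count of the ways to empty `S` by successive moves, the moves carrying weights `c` and
the `t`-th move an additional weight, given by the `t`-th entry of the list, depending only on its
direction. -/
noncomputable def removalSum (c : β × Bool → ℝ) : List (Bool → ℝ) → Finset β → ℝ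
  | [], _ => 1
  | h :: l, S => ∑ i ∈ avail S, c i * h i.2 * removalSum c l (S.erase i.1)

/-- The linear form obtained from `removalSum` by giving the first move an arbitrary weight. -/
noncomputable def removalForm (c : β × Bool → ℝ) (l : List (Bool → ℝ)) (S : Finset β)
    (v : β × Bool → ℝ) : ℝ :=
  ∑ i ∈ avail S, c i * v i * removalSum c l (S.erase i.1)

/-- Transport of weights along the move `i`: moves that become available inherit the weight of
`i`. -/
noncomputable def transport (S : Finset β) (i : β × Bool) (v : β × Bool → ℝ) (j : β × Bool) : ℝ :=
  if j ∈ avail S then v j else v i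

/-- The bilinear form obtained from `removalSum` by giving the first two moves arbitrary weights. -/
noncomputable def removalBilin (c : β × Bool → ℝ) (l : List (Bool → ℝ)) (S : Finset β)
    (v w : β × Bool → ℝ) : ℝ :=
  ∑ i ∈ avail S, c i * v i * removalForm c l (S.erase i.1) (transport S i w)

variable {c : β × Bool → ℝ} {l : List (Bool → ℝ)} {S : Finset β}

theorem removalForm_congr {v w : β × Bool → ℝ} (h : ∀ i ∈ avail S, v i = w i) :
    removalForm c l S v = removalForm c l S w :=
  Finset.sum_congr rfl fun i hi => by rw [h i hi]

theorem removalForm_snd (h : Bool → ℝ) :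
    removalForm c l S (fun i => h i.2) = removalSum c (h :: l) S := rfl

theorem removalForm_transport_snd (h : Bool → ℝ) {i : β × Bool} (hi : i ∈ avail S) :
    removalForm c l (S.erase i.1) (transport S i (fun j => h j.2)) =
      removalSum c (h :: l) (S.erase i.1) := by
  rw [← removalForm_snd]
  refine removalForm_congr fun j hj => ?_
  rw [transport]
  split_ifs with h1
  · rfl
  · rw [snd_eq_of_mem_avail_erase hi hj h1]

theorem removalBilin_snd (v : β × Bool → ℝ) (h : Bool → ℝ) :
    removalBilin c l S v (fun j => h j.2) = removalForm c (h :: l) S v :=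
  Finset.sum_congr rfl fun i hi => by rw [removalForm_transport_snd h hi]

theorem sum_avail_erase (F : β × Bool → β × Bool → ℝ) :
    ∑ i ∈ avail S, ∑ j ∈ avail (S.erase i.1), F i j =
      ∑ i ∈ avail S, ∑ j ∈ avail S, (if j.1 = i.1 then 0 else F i j) +
        ∑ i ∈ avail S, ∑ j ∈ avail (S.erase i.1) with j ∉ avail S, F i j := by
  rw [← Finset.sum_add_distrib]
  refine Finset.sum_congr rfl fun i _ => ?_
  rw [← Finset.sum_filter_add_sum_filter_not (avail (S.erase i.1)) (fun j => j ∈ avail S)]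
  congr 1
  simp only [← ite_not (p := _ = _), ← Finset.sum_filter]
  refine Finset.sum_congr ?_ fun _ _ => rfl
  ext j
  simp only [mem_filter]
  exact ⟨fun h => ⟨h.2, fst_ne_of_mem_avail_erase h.1⟩,
    fun h => ⟨mem_avail_erase_of_mem h.1 h.2, h.1⟩⟩

theorem removalBilin_eq_sum (v w : β × Bool → ℝ) :
    removalBilin c l S v w = ∑ i ∈ avail S, ∑ j ∈ avail (S.erase i.1),
      c i * c j * v i * transport S i w j * removalSum c l ((S.erase i.1).erase j.1) := by
  refine Finset.sum_congr rfl fun i _ => ?_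
  rw [removalForm, Finset.mul_sum]
  exact Finset.sum_congr rfl fun j _ => by ring

theorem removalBilin_comm (v w : β × Bool → ℝ) :
    removalBilin c l S v w = removalBilin c l S w v := by
  rw [removalBilin_eq_sum, removalBilin_eq_sum, sum_avail_erase, sum_avail_erase]
  congr 1
  · rw [Finset.sum_comm]
    refine Finset.sum_congr rfl fun i hi => Finset.sum_congr rfl fun j hj => ?_
    by_cases h : j.1 = i.1
    · simp [h]
    · rw [if_neg h, if_neg (Ne.symm h), transport, if_pos hi, transport, if_pos hj,
        erase_right_comm]
      ring
  · refine Finset.sum_congr rfl fun i hi => Finset.sum_congr rfl fun j hj => ?_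
    rw [transport, if_neg (mem_filter.1 hj).2, transport, if_neg (mem_filter.1 hj).2]
    ring

theorem removalSum_pos (hc : ∀ i, 0 < c i) (hl : ∀ h ∈ l, ∀ b, 0 < h b) (hS : #S = l.length) :
    0 < removalSum c l S := by
  induction l generalizing S with
  | nil => exact one_pos
  | cons h l ih =>
    obtain ⟨x, hx⟩ := exists_mem_avail (S := S) (card_pos.1 (by simp [hS])) false
    refine Finset.sum_pos (fun i hi => ?_) ⟨_, hx⟩
    refine mul_pos (mul_pos (hc i) (hl h (by simp) _)) (ih (fun g hg => hl g (by simp [hg])) ?_)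
    rw [card_erase_of_mem (mem_avail.1 hi).1, hS]; simp

theorem removalSum_nonneg (hc : ∀ i, 0 ≤ c i) (hl : ∀ h ∈ l, ∀ b, 0 ≤ h b) :
    0 ≤ removalSum c l S := by
  induction l generalizing S with
  | nil => exact zero_le_one
  | cons h l ih =>
    exact Finset.sum_nonneg fun i _ => mul_nonneg (mul_nonneg (hc i) (hl h (by simp) _))
      (ih (fun g hg => hl g (by simp [hg])))

/-- The sum of the transported forms dominates the original form. -/
theorem removalBilin_self_le (hc : ∀ i, 0 ≤ c i) (hl : ∀ h ∈ l, ∀ b, 0 ≤ h b)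
    (h : Bool → ℝ) (hh : ∀ b, 0 ≤ h b) (v : β × Bool → ℝ) :
    removalBilin c (h :: l) S v v ≤ ∑ i ∈ avail S, c i * h i.2 *
      removalBilin c l (S.erase i.1) (transport S i v) (transport S i v) := by
  have e1 : removalBilin c (h :: l) S v v = ∑ i ∈ avail S, ∑ j ∈ avail (S.erase i.1),
      c i * c j * (v i * h j.2) * removalForm c l ((S.erase i.1).erase j.1)
        (transport (S.erase i.1) j (transport S i v)) := by
    refine Finset.sum_congr rfl fun i _ => ?_
    rw [← removalBilin_snd, removalBilin_comm, removalBilin, Finset.mul_sum]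
    exact Finset.sum_congr rfl fun j _ => by ring
  have e2 : ∑ i ∈ avail S, c i * h i.2 *
      removalBilin c l (S.erase i.1) (transport S i v) (transport S i v) =
      ∑ i ∈ avail S, ∑ j ∈ avail (S.erase i.1),
      c i * c j * (h i.2 * transport S i v j) * removalForm c l ((S.erase i.1).erase j.1)
        (transport (S.erase i.1) j (transport S i v)) := by
    refine Finset.sum_congr rfl fun i _ => ?_
    rw [removalBilin, Finset.mul_sum]
    exact Finset.sum_congr rfl fun j _ => by ring
  rw [e1, e2, ← sub_nonneg]
  simp only [← Finset.sum_sub_distrib]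
  rw [sum_avail_erase]
  refine add_nonneg ?_ (le_of_eq (Eq.symm ?_))
  · set F : β × Bool → β × Bool → ℝ := fun i j => if j.1 = i.1 then 0 else
      c i * c j * (h i.2 * transport S i v j) * removalForm c l ((S.erase i.1).erase j.1)
        (transport (S.erase i.1) j (transport S i v)) -
      c i * c j * (v i * h j.2) * removalForm c l ((S.erase i.1).erase j.1)
        (transport (S.erase i.1) j (transport S i v)) with hF
    have key : ∀ i ∈ avail S, ∀ j ∈ avail S, 0 ≤ F i j + F j i := by
      intro i hi j hj
      by_cases hij : j.1 = i.1
      · simp [hF, hij]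
      have hji : ¬ i.1 = j.1 := Ne.symm hij
      simp only [hF, if_neg hij, if_neg hji]
      rw [erase_right_comm (a := j.1) (b := i.1)]
      have e3 : transport S i v j = v j := if_pos hj
      have e4 : transport S j v i = v i := if_pos hi
      rw [e3, e4]
      set X := removalForm c l ((S.erase i.1).erase j.1)
        (transport (S.erase i.1) j (transport S i v))
      set Y := removalForm c l ((S.erase i.1).erase j.1)
        (transport (S.erase j.1) i (transport S j v))
      have e5 : (h i.2 * v j - v i * h j.2) * (X - Y) = ∑ m ∈ avail ((S.erase i.1).erase j.1),
          c m * removalSum c l (((S.erase i.1).erase j.1).erase m.1) *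
          ((h i.2 * v j - v i * h j.2) * (transport (S.erase i.1) j (transport S i v) m -
            transport (S.erase j.1) i (transport S j v) m)) := by
        simp only [X, Y, removalForm]
        rw [← Finset.sum_sub_distrib, Finset.mul_sum]
        exact Finset.sum_congr rfl fun m _ => by ring
      have e6 : 0 ≤ (h i.2 * v j - v i * h j.2) * (X - Y) := by
        rw [e5]
        refine Finset.sum_nonneg fun m hm => mul_nonneg
          (mul_nonneg (hc m) (removalSum_nonneg hc hl)) ?_
        by_cases m1 : m ∈ avail (S.erase i.1) <;> by_cases m2 : m ∈ avail (S.erase j.1)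
        · have m3 := mem_avail_of_erase_of_erase hji m1 m2
          simp [transport, m1, m2, m3]
        · have m3 : m ∉ avail S := fun h3 => m2 (mem_avail_erase_of_mem h3 (by
            exact fst_ne_of_mem_avail_erase hm))
          simp [transport, m1, m2, m3, hi]
        · have m3 : m ∉ avail S := fun h3 => m1 (mem_avail_erase_of_mem h3 (by
            rw [erase_right_comm] at hm
            exact fst_ne_of_mem_avail_erase hm))
          simp [transport, m1, m2, m3, hj]
        · have d1 := snd_eq_of_mem_avail_erase (mem_avail_erase_of_mem hj hij) hm m1
          have d2 := snd_eq_of_mem_avail_erase (mem_avail_erase_of_mem hi hji)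
            (by rwa [erase_right_comm] at hm) m2
          simp only [transport, m1, m2, hi, hj, if_true, if_false]
          rw [← d1, ← d2]
          nlinarith [mul_nonneg (hh m.2) (sq_nonneg (v j - v i))]
      nlinarith [mul_nonneg (mul_nonneg (hc i) (hc j)) e6]
    have e7 : 2 * ∑ i ∈ avail S, ∑ j ∈ avail S, F i j =
        ∑ i ∈ avail S, ∑ j ∈ avail S, (F i j + F j i) := by
      simp only [Finset.sum_add_distrib]
      rw [Finset.sum_comm (f := fun i j => F j i)]; ring
    have e8 := Finset.sum_nonneg fun i hi => Finset.sum_nonneg fun j hj => key i hi j hj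
    linarith
  · refine Finset.sum_eq_zero fun i hi => Finset.sum_eq_zero fun j hj => ?_
    have hj' := mem_filter.1 hj
    rw [snd_eq_of_mem_avail_erase hi hj'.1 hj'.2]
    have : transport S i v j = v i := if_neg hj'.2
    rw [this]; ring

theorem card_erase_fst_of_mem_avail {i : β × Bool} (hi : i ∈ avail S) {n : ℕ} (hS : #S = n + 1) :
    #(S.erase i.1) = n := by
  rw [card_erase_of_mem (mem_avail.1 hi).1, hS]; rfl

theorem removalBilin_add_mul_left (a b : ℝ) (u v w : β × Bool → ℝ) :
    removalBilin c l S (fun i => a * u i + b * v i) w =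
      a * removalBilin c l S u w + b * removalBilin c l S v w := by
  simp only [removalBilin, Finset.mul_sum, ← Finset.sum_add_distrib]
  exact Finset.sum_congr rfl fun i _ => by ring

theorem removalBilin_add_mul_right (a b : ℝ) (u v w : β × Bool → ℝ) :
    removalBilin c l S w (fun i => a * u i + b * v i) =
      a * removalBilin c l S w u + b * removalBilin c l S w v := by
  rw [removalBilin_comm, removalBilin_add_mul_left, removalBilin_comm u, removalBilin_comm v]

theorem avail_singleton (x : β) : avail {x} = {(x, false), (x, true)} := by
  ext ⟨y, d⟩
  simp only [mem_avail, mem_singleton, forall_eq, mem_insert, Prod.mk.injEq]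
  cases d <;> simp +contextual [Blocks]

theorem avail_pair_of_lt {x y : β} (h : x < y) : avail {x, y} = {(x, false), (y, true)} := by
  ext ⟨m, d⟩
  have := h.ne
  have := h.ne'
  have := h.not_gt
  simp only [mem_avail, mem_singleton, mem_insert, Prod.mk.injEq, forall_eq_or_imp, forall_eq]
  constructor
  · rintro ⟨rfl | rfl, h2⟩ <;> cases d <;> simp_all [Blocks]
  · rintro (⟨rfl, rfl⟩ | ⟨rfl, rfl⟩) <;> simp_all [Blocks]

theorem avail_pair_of_not_lt {x y : β} (h : ¬ x < y) (h' : ¬ y < x) :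
    avail {x, y} = {(x, false), (x, true), (y, false), (y, true)} := by
  ext ⟨m, d⟩
  simp only [mem_avail, mem_singleton, mem_insert, Prod.mk.injEq, forall_eq_or_imp, forall_eq]
  constructor
  · rintro ⟨rfl | rfl, h2⟩ <;> cases d <;> simp
  · rintro (⟨rfl, rfl⟩ | ⟨rfl, rfl⟩ | ⟨rfl, rfl⟩ | ⟨rfl, rfl⟩) <;> simp_all [Blocks]

theorem erase_pair_left {γ : Type*} {x y : γ} (h : x ≠ y) : ({x, y} : Finset γ).erase x = {y} :=
  erase_insert (by simpa using h)

theorem erase_pair_right {γ : Type*} {x y : γ} (h : x ≠ y) : ({x, y} : Finset γ).erase y = {x} := by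
  rw [pair_comm, erase_pair_left h.symm]

theorem removalForm_singleton (x : β) (v : β × Bool → ℝ) :
    removalForm c [] {x} v = c (x, false) * v (x, false) + c (x, true) * v (x, true) := by
  simp [removalForm, avail_singleton, removalSum]

theorem removalBilin_pair_of_lt {x y : β} (h : x < y) (v w : β × Bool → ℝ) :
    removalBilin c [] {x, y} v w =
      c (x, false) * c (y, false) * (v (x, false) * w (x, false)) +
      c (x, false) * c (y, true) * (v (x, false) * w (y, true) + v (y, true) * w (x, false)) +
      c (x, true) * c (y, true) * (v (y, true) * w (y, true)) := by
  rw [removalBilin, avail_pair_of_lt h, sum_pair (by simp), erase_pair_left h.ne,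
    erase_pair_right h.ne, removalForm_singleton,
    removalForm_singleton]
  simp only [transport, avail_pair_of_lt h, mem_insert, mem_singleton, Prod.mk.injEq, h.ne, h.ne']
  simp
  ring

theorem removalBilin_pair_of_not_lt {x y : β} (hxy : x ≠ y) (h : ¬ x < y) (h' : ¬ y < x)
    (v w : β × Bool → ℝ) :
    removalBilin c [] {x, y} v w =
      (c (x, false) * v (x, false) + c (x, true) * v (x, true)) *
        (c (y, false) * w (y, false) + c (y, true) * w (y, true)) +
      (c (y, false) * v (y, false) + c (y, true) * v (y, true)) *
        (c (x, false) * w (x, false) + c (x, true) * w (x, true)) := by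
  rw [removalBilin, avail_pair_of_not_lt h h', sum_insert (by simp [hxy]),
    sum_insert (by simp [hxy]), sum_pair (by simp), erase_pair_left hxy, erase_pair_right hxy]
  simp only [removalForm_singleton, transport, avail_pair_of_not_lt h h', mem_insert,
    mem_singleton, Prod.mk.injEq]
  simp
  ring

theorem removalBilin_pair_mul_le (hc : ∀ i, 0 < c i)
    (hcc : ∀ x y, x < y → c (y, false) * c (x, true) ≤ c (x, false) * c (y, true))
    (hS : #S = 2) (v w : β × Bool → ℝ) :
    removalBilin c [] S v v * removalBilin c [] S w w ≤ removalBilin c [] S v w ^ 2 := by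
  have key : ∀ x y, x < y → removalBilin c [] {x, y} v v * removalBilin c [] {x, y} w w ≤
      removalBilin c [] {x, y} v w ^ 2 := by
    intro x y h
    simp only [removalBilin_pair_of_lt h]
    have h1 : 0 ≤ (c (x, false) * c (y, true)) *
        (c (x, false) * c (y, true) - c (y, false) * c (x, true)) :=
      mul_nonneg (mul_pos (hc _) (hc _)).le (sub_nonneg.2 (hcc x y h))
    have h2 := mul_nonneg h1
      (sq_nonneg (v (x, false) * w (y, true) - v (y, true) * w (x, false)))
    rw [← sub_nonneg]
    refine h2.trans (le_of_eq ?_)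
    ring
  obtain ⟨x, y, hxy, rfl⟩ := card_eq_two.1 hS
  by_cases h : x < y
  · exact key x y h
  by_cases h' : y < x
  · rw [pair_comm]; exact key y x h'
  simp only [removalBilin_pair_of_not_lt hxy h h']
  rw [← sub_nonneg]
  refine (sq_nonneg ((c (x, false) * v (x, false) + c (x, true) * v (x, true)) *
        (c (y, false) * w (y, false) + c (y, true) * w (y, true)) -
      (c (y, false) * v (y, false) + c (y, true) * v (y, true)) *
        (c (x, false) * w (x, false) + c (x, true) * w (x, true)))).trans (le_of_eq ?_)
  ring

theorem sum_transport_single (i m : β × Bool) (hi : i ∈ avail S) (v : β × Bool → ℝ) :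
    ∑ j ∈ avail S, transport S i (Pi.single j 1) m * v j = transport S i v m := by
  by_cases hm : m ∈ avail S
  · simp [transport, hm, Pi.single_apply]
  · simp [transport, hm, Pi.single_apply, hi]

theorem removalBilin_single (i j : β × Bool) (hi : i ∈ avail S) :
    removalBilin c l S (Pi.single i 1) (Pi.single j 1) =
      c i * removalForm c l (S.erase i.1) (transport S i (Pi.single j 1)) := by
  rw [removalBilin, Finset.sum_eq_single i]
  · simp
  · intro b _ hb; simp [hb]
  · intro h; exact absurd hi h

theorem sum_removalBilin_single (i : β × Bool) (hi : i ∈ avail S) (v : β × Bool → ℝ) :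
    ∑ j ∈ avail S, removalBilin c l S (Pi.single i 1) (Pi.single j 1) * v j =
      c i * removalForm c l (S.erase i.1) (transport S i v) := by
  simp only [removalBilin_single i _ hi, removalForm, ← sum_transport_single i _ hi v,
    Finset.mul_sum, Finset.sum_mul]
  rw [Finset.sum_comm]
  exact Finset.sum_congr rfl fun m _ => Finset.sum_congr rfl fun j _ => by ring

theorem removalBilin_nonneg (hc : ∀ i, 0 ≤ c i) (hl : ∀ h ∈ l, ∀ b, 0 ≤ h b)
    {v w : β × Bool → ℝ} (hv : ∀ i, 0 ≤ v i) (hw : ∀ i, 0 ≤ w i) :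
    0 ≤ removalBilin c l S v w := by
  rw [removalBilin_eq_sum]
  refine Finset.sum_nonneg fun i _ => Finset.sum_nonneg fun j _ => ?_
  have : 0 ≤ transport S i w j := by rw [transport]; split_ifs <;> exact hw _
  exact mul_nonneg (mul_nonneg (mul_nonneg (mul_nonneg (hc i) (hc j)) (hv i)) this)
    (removalSum_nonneg hc hl)

theorem removalBilin_single_pos (hc : ∀ i, 0 < c i) (hl : ∀ h ∈ l, ∀ b, 0 < h b)
    (hS : #S = l.length + 2) {i j : β × Bool} (hi : i ∈ avail S) (hj : j ∈ avail S)
    (hij : j.1 ≠ i.1) : 0 < removalBilin c l S (Pi.single i 1) (Pi.single j 1) := by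
  rw [removalBilin_single i j hi]
  have hj' := mem_avail_erase_of_mem hj hij
  have hpos : ∀ m ∈ avail (S.erase i.1), 0 < removalSum c l ((S.erase i.1).erase m.1) :=
    fun m hm => removalSum_pos hc hl
      (card_erase_fst_of_mem_avail hm (card_erase_fst_of_mem_avail hi hS))
  have h0 : ∀ m, 0 ≤ (Pi.single j 1 : β × Bool → ℝ) m := fun m => by
    rw [Pi.single_apply]; split_ifs <;> norm_num
  refine mul_pos (hc i) (Finset.sum_pos' (fun m hm => ?_) ⟨j, hj', ?_⟩)
  · refine mul_nonneg (mul_nonneg (hc m).le ?_) (hpos m hm).le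
    rw [transport]; split_ifs <;> exact h0 _
  · refine mul_pos (mul_pos (hc j) ?_) (hpos j hj')
    rw [transport, if_pos hj]; simp

theorem eq_of_forall_fst_ne (hS : 1 < #S) (u : β × Bool → ℝ)
    (hu : ∀ i ∈ avail S, ∀ j ∈ avail S, j.1 ≠ i.1 → u i = u j) :
    ∀ i ∈ avail S, ∀ j ∈ avail S, u i = u j := by
  have key : ∀ x, (x, true) ∈ avail S → (x, false) ∈ avail S → u (x, true) = u (x, false) := by
    intro x h1 h2
    obtain ⟨m, hm⟩ := exists_mem_avail (S := S.erase x)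
      (card_pos.1 (by rw [card_erase_of_mem (mem_avail.1 h1).1]; omega)) false
    have hmx : m ≠ x := fst_ne_of_mem_avail_erase hm
    have hmS : (m, false) ∈ avail S := by
      by_contra h
      simpa using snd_eq_of_mem_avail_erase h1 hm h
    rw [hu _ h1 _ hmS hmx, hu _ h2 _ hmS hmx]
  rintro ⟨x, a⟩ hi ⟨y, b⟩ hj
  by_cases h : y = x
  · subst h
    cases a <;> cases b
    · rfl
    · exact (key y hj hi).symm
    · exact key y hi hj
    · rfl
  · exact hu _ hi _ hj h

/-- If `removalBilin` is negative semidefinite on the orthogonal complement of some `g`, it satisfies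
the reversed Cauchy–Schwarz inequality. -/
theorem removalBilin_mul_le_of_nonpos (g : β × Bool → ℝ)
    (hg : ∀ v, removalBilin c l S v g = 0 → removalBilin c l S v v ≤ 0)
    (v w : β × Bool → ℝ) (hw : 0 < removalBilin c l S w w) :
    removalBilin c l S v v * removalBilin c l S w w ≤ removalBilin c l S v w ^ 2 := by
  by_cases hv : removalBilin c l S v v ≤ 0
  · exact (mul_nonpos_of_nonpos_of_nonneg hv hw.le).trans (sq_nonneg _)
  have hvg : removalBilin c l S v g ≠ 0 := fun h => hv (hg v h)
  have h1 := hg (fun i => removalBilin c l S v g * w i + (-removalBilin c l S w g) * v i) (by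
    rw [removalBilin_add_mul_left]; ring)
  rw [removalBilin_add_mul_left, removalBilin_add_mul_right, removalBilin_add_mul_right,
    removalBilin_comm w v] at h1
  set a := removalBilin c l S v g
  set b := removalBilin c l S w g
  set p := removalBilin c l S v v
  set q := removalBilin c l S v w
  set r := removalBilin c l S w w
  have ha : 0 < a ^ 2 := by positivity
  push Not at hv
  have h2 : a ^ 2 * (p * r - q ^ 2) ≤ 0 := by
    nlinarith [sq_nonneg (b * p - a * q), mul_nonneg hv.le (sub_nonneg.2 h1)]
  by_contra h3
  push Not at h3
  nlinarith [mul_pos ha (sub_pos.2 h3)]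

/-- The bilinear form `removalBilin` is hyperbolic when the ratio of the weights of bottom and top
moves is antitone. -/
theorem removalBilin_mul_le (hc : ∀ i, 0 < c i)
    (hcc : ∀ x y, x < y → c (y, false) * c (x, true) ≤ c (x, false) * c (y, true))
    (hl : ∀ h ∈ l, ∀ b, 0 < h b) (hS : #S = l.length + 2) (v w : β × Bool → ℝ)
    (hw : 0 < removalBilin c l S w w) :
    removalBilin c l S v v * removalBilin c l S w w ≤ removalBilin c l S v w ^ 2 := by
  induction l generalizing S v w with
  | nil => exact removalBilin_pair_mul_le hc hcc hS v w
  | cons h l ih =>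
    have hh : ∀ b, 0 < h b := hl h (by simp)
    have hl' : ∀ g ∈ l, ∀ b, 0 < g b := fun g hg => hl g (by simp [hg])
    refine removalBilin_mul_le_of_nonpos (fun i => h i.2) (fun v hv => ?_) v w hw
    let M : Matrix (avail S) (avail S) ℝ := Matrix.of fun i j =>
      removalBilin c (h :: l) S (Pi.single i.1 1) (Pi.single j.1 1)
    have hM : ∀ (v : β × Bool → ℝ) (i : avail S), M.mulVec (fun j => v j.1) i =
        c i.1 * removalForm c (h :: l) (S.erase i.1.1) (transport S i.1 v) := by
      intro v i
      rw [← sum_removalBilin_single i.1 i.2 v, ← Finset.sum_coe_sort]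
      rfl
    have hB : ∀ v w : β × Bool → ℝ, (fun j : avail S => v j.1) ⬝ᵥ M.mulVec (fun j => w j.1) =
        removalBilin c (h :: l) S v w := by
      intro v w
      rw [removalBilin, ← Finset.sum_coe_sort]
      refine Finset.sum_congr rfl fun i _ => ?_
      rw [hM]; ring
    have hcard : ∀ i ∈ avail S, #(S.erase i.1) = l.length + 2 := fun i hi =>
      card_erase_fst_of_mem_avail hi (by rw [hS]; simp)
    have hpos : ∀ i ∈ avail S, 0 < removalSum c (h :: h :: l) (S.erase i.1) := fun i hi =>
      removalSum_pos hc (by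
        simpa using ⟨Bool.forall_bool.1 hh, fun g hg => Bool.forall_bool.1 (hl' g hg)⟩)
        (by rw [hcard i hi]; simp)
    have hMh : ∀ i : avail S, M.mulVec (fun j => h j.1.2) i =
        c i.1 * removalSum c (h :: h :: l) (S.erase i.1.1) := by
      intro i
      rw [hM (fun j => h j.2), removalForm_transport_snd h i.2]
    rw [← hB]
    refine dotProduct_mulVec_nonpos_of_weighted M ?_ ?_ (fun i => h i.1.2) (fun i => hh _) ?_ ?_ ?_
      _ ?_
    · ext i j
      exact removalBilin_comm _ _
    · have h0 : ∀ j m, 0 ≤ (Pi.single j 1 : β × Bool → ℝ) m := fun j m => by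
        rw [Pi.single_apply]; split_ifs <;> norm_num
      exact fun i j => removalBilin_nonneg (fun i => (hc i).le) (fun g hg b => (hl g hg b).le)
        (h0 _) (h0 _)
    · intro i
      rw [hMh]
      exact mul_pos (hc _) (hpos _ i.2)
    · intro u hu i j
      obtain ⟨u, rfl⟩ : ∃ u' : β × Bool → ℝ, u = fun i => u' i.1 :=
        ⟨Function.extend Subtype.val u 0, funext fun i =>
          (Subtype.val_injective.extend_apply u 0 i).symm⟩
      refine eq_of_forall_fst_ne (by rw [hS]; simp) u (fun i hi j hj hij => ?_) _ i.2 _ j.2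
      exact hu ⟨i, hi⟩ ⟨j, hj⟩ (removalBilin_single_pos hc hl hS hi hj hij).ne'
    · intro u
      obtain ⟨u, rfl⟩ : ∃ u' : β × Bool → ℝ, u = fun i => u' i.1 :=
        ⟨Function.extend Subtype.val u 0, funext fun i =>
          (Subtype.val_injective.extend_apply u 0 i).symm⟩
      rw [hB]
      refine (removalBilin_self_le (fun i => (hc i).le) (fun g hg b => (hl' g hg b).le) h
        (fun b => (hh b).le) u).trans ?_
      rw [← Finset.sum_coe_sort]
      refine Finset.sum_le_sum fun i _ => ?_
      rw [hMh, hM, ← removalBilin_snd]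
      have hp := hpos i.1 i.2
      have e : removalBilin c l (S.erase i.1.1) (fun j => h j.2) (fun j => h j.2) =
          removalSum c (h :: h :: l) (S.erase i.1.1) := by
        rw [removalBilin_snd, removalForm_snd]
      have h1 := ih hl' (hcard _ i.2) (transport S i.1 u) (fun j => h j.2) (by rwa [e])
      rw [e] at h1
      rw [le_div_iff₀ (mul_pos (hc _) hp)]
      have h2 := mul_nonneg (mul_nonneg (hh i.1.2).le (sq_nonneg (c i.1))) (sub_nonneg.2 h1)
      nlinarith [h2]
    · rw [hB v (fun j => h j.2)]
      exact hv

/-- Log-concavity of `removalSum` in the weights of the first two moves. -/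
theorem removalSum_mul_le (hc : ∀ i, 0 < c i)
    (hcc : ∀ x y, x < y → c (y, false) * c (x, true) ≤ c (x, false) * c (y, true))
    (hl : ∀ h ∈ l, ∀ b, 0 < h b) (hS : #S = l.length + 2) (g h : Bool → ℝ)
    (hh : ∀ b, 0 < h b) :
    removalSum c (g :: g :: l) S * removalSum c (h :: h :: l) S ≤
      removalSum c (h :: g :: l) S ^ 2 := by
  have e : ∀ g h : Bool → ℝ, removalBilin c l S (fun i => g i.2) (fun i => h i.2) =
      removalSum c (g :: h :: l) S := fun g h => by
    rw [removalBilin_snd, removalForm_snd]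
  have h0 : 0 < removalSum c (h :: h :: l) S := by
    refine removalSum_pos hc ?_ (by rw [hS]; simp)
    simpa using ⟨Bool.forall_bool.1 hh, fun g hg => Bool.forall_bool.1 (hl g hg)⟩
  rw [← e h h] at h0
  have h1 := removalBilin_mul_le hc hcc hl hS (fun i => g i.2) (fun i => h i.2) h0
  rwa [e g g, e h h, removalBilin_comm, e h g] at h1

/-- The weights of moves on a poset with a distinguished element `z`: the value `ε` penalizes
removing an element above `z` from the bottom, or an element below `z` from the top. -/
noncomputable def moveWeight (z : β) (ε : ℝ) (i : β × Bool) : ℝ := if Blocks i z then ε else 1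

/-- The weights on directions selecting the direction `d` when `ε = 0`. -/
noncomputable def dirWeight (ε : ℝ) (d : Bool) (b : Bool) : ℝ := if b = d then 1 else ε

theorem continuous_removalSum (z : β) (D : List Bool) (S : Finset β) :
    Continuous fun ε => removalSum (moveWeight z ε) (D.map (dirWeight ε)) S := by
  induction D generalizing S with
  | nil => exact continuous_const
  | cons d D ih =>
    simp only [List.map_cons, removalSum]
    refine continuous_finsetSum _ fun i _ => (Continuous.mul ?_ ?_).mul (ih _)
    · unfold moveWeight; split_ifs <;> fun_prop
    · unfold dirWeight; split_ifs <;> fun_prop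

theorem moveWeight_mul_le (z : β) {ε : ℝ} (h0 : 0 < ε) (h1 : ε ≤ 1) {x y : β} (hxy : x < y) :
    moveWeight z ε (y, false) * moveWeight z ε (x, true) ≤
      moveWeight z ε (x, false) * moveWeight z ε (y, true) := by
  have pos : ∀ i, 0 ≤ moveWeight z ε i := fun i => by
    rw [moveWeight]; split_ifs <;> linarith
  refine mul_le_mul ?_ ?_ (pos _) (pos _)
  · by_cases h : z < x
    · simp [moveWeight, Blocks, h, h.trans hxy]
    · rw [moveWeight, moveWeight, if_neg (show ¬ Blocks (x, false) z from h)]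
      split_ifs
      exacts [h1, le_rfl]
  · by_cases h : y < z
    · simp [moveWeight, Blocks, h, hxy.trans h]
    · rw [moveWeight, moveWeight, if_neg (show ¬ Blocks (y, true) z from h)]
      split_ifs
      exacts [h1, le_rfl]

theorem removalSum_dirWeight_zero_mul_le (z : β) (D : List Bool) (hS : #S = D.length + 2) :
    removalSum (moveWeight z 0) ((false :: false :: D).map (dirWeight 0)) S *
      removalSum (moveWeight z 0) ((true :: true :: D).map (dirWeight 0)) S ≤
    removalSum (moveWeight z 0) ((true :: false :: D).map (dirWeight 0)) S ^ 2 := by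
  have cont := fun D' => continuous_removalSum z D' S
  have h1 := ((cont (false :: false :: D)).mul (cont (true :: true :: D))).continuousAt (x := 0)
  have h2 := ((cont (true :: false :: D)).pow 2).continuousAt (x := 0)
  refine le_of_tendsto_of_tendsto (h1.tendsto.mono_left (nhdsWithin_le_nhds (s := Set.Ioi 0)))
    (h2.tendsto.mono_left nhdsWithin_le_nhds) ?_
  filter_upwards [Ioc_mem_nhdsGT (zero_lt_one (α := ℝ))] with ε hε
  have hd : ∀ d b, 0 < dirWeight ε d b := fun d b => by
    rw [dirWeight]; split_ifs
    exacts [one_pos, hε.1]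
  refine removalSum_mul_le (l := D.map (dirWeight ε)) (fun i => ?_)
    (fun x y => moveWeight_mul_le z hε.1 hε.2) ?_ (by simpa using hS) _ _ (hd true)
  · rw [moveWeight]; split_ifs
    exacts [hε.1, one_pos]
  · intro h hh
    obtain ⟨d, -, rfl⟩ := List.mem_map.1 hh
    exact hd d

/-- The order-preserving bijections from `S ∪ {z}` to `R`, extended by `0`. -/
noncomputable def placements [Fintype β] (z : β) (S : Finset β) (R : Finset ℤ) :
    Finset (β → ℤ) :=
  {f ∈ Fintype.piFinset fun _ => insert 0 R | (∀ x ∉ S, f x = 0) ∧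
    Set.BijOn f (insert z S) R ∧ StrictMonoOn f (insert z S)}

theorem mem_placements [Fintype β] {z : β} {R : Finset ℤ} {f : β → ℤ} :
    f ∈ placements z S R ↔ (∀ x ∉ S, f x = 0) ∧
      Set.BijOn f (insert z S) R ∧ StrictMonoOn f (insert z S) := by
  simp only [placements, mem_filter, Fintype.mem_piFinset, and_iff_right_iff_imp]
  rintro ⟨h1, h2, -⟩ x
  by_cases hx : x ∈ S
  · exact mem_insert_of_mem (h2.mapsTo (Set.mem_insert_of_mem _ hx))
  · rw [h1 x hx]; exact mem_insert_self _ _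

/-- `e` is the extreme element of `R` in the direction `d`. -/
def IsExtremeIn (d : Bool) (R : Finset ℤ) (e : ℤ) : Prop :=
  ∀ r ∈ R, r ≠ e → bif d then r < e else e < r

theorem update_mem_placements [Fintype β] {z : β} (hz : z ∉ S) {R : Finset ℤ} {e : ℤ}
    (he : e ∈ R) {d : Bool} (hR : IsExtremeIn d R e) {x : β} (hx : (x, d) ∈ avail S)
    (hxz : ¬ Blocks (x, d) z) {f : β → ℤ} (hf : f ∈ placements z (S.erase x) (R.erase e)) :
    Function.update f x e ∈ placements z S R := by
  rw [mem_placements] at *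
  obtain ⟨h1, h2, h3⟩ := hf
  have hxS := (mem_avail.1 hx).1
  have hzx : z ≠ x := fun h => hz (h ▸ hxS)
  have hmem : ∀ y, y ∈ insert z (S : Set β) → y ≠ x →
      y ∈ insert z ((S.erase x : Finset β) : Set β) := by
    intro y hy hyx
    simpa [hyx] using hy
  have hmaps : ∀ y, y ∈ insert z (S : Set β) → y ≠ x → f y ∈ R ∧ f y ≠ e := by
    intro y hy hyx
    have := h2.mapsTo (hmem y hy hyx)
    simp at this
    exact this
  refine ⟨fun y hy => ?_, ⟨fun y hy => ?_, fun y hy y' hy' hyy => ?_, fun r hr => ?_⟩,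
    fun y hy y' hy' hyy => ?_⟩
  · rw [Function.update_of_ne fun h : y = x => hy (h ▸ hxS)]
    exact h1 y (fun h => hy (mem_of_mem_erase h))
  · by_cases hyx : y = x
    · simpa [hyx] using he
    · rw [Function.update_of_ne hyx]
      exact (hmaps y hy hyx).1
  · by_cases hyx : y = x <;> by_cases hyx' : y' = x
    · rw [hyx, hyx']
    · rw [hyx, Function.update_self, Function.update_of_ne hyx'] at hyy
      exact absurd hyy.symm (hmaps y' hy' hyx').2
    · rw [hyx', Function.update_self, Function.update_of_ne hyx] at hyy
      exact absurd hyy (hmaps y hy hyx).2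
    · rw [Function.update_of_ne hyx, Function.update_of_ne hyx'] at hyy
      exact h2.injOn (hmem y hy hyx) (hmem y' hy' hyx') hyy
  · by_cases hre : r = e
    · exact ⟨x, Set.mem_insert_of_mem _ hxS, by simp [hre]⟩
    · obtain ⟨y, hy, rfl⟩ := h2.surjOn (mem_coe.2 (mem_erase.2 ⟨hre, hr⟩))
      have hyx : y ≠ x := by
        rintro rfl
        simp [hzx.symm] at hy
      refine ⟨y, ?_, Function.update_of_ne hyx _ _⟩
      simp only [Set.mem_insert_iff, mem_coe, mem_erase] at hy ⊢
      tauto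
  · have hb : ∀ m ∈ insert z (S : Set β), ¬ Blocks (x, d) m := by
      rintro m (rfl | hm)
      · exact hxz
      · exact (mem_avail.1 hx).2 m hm
    by_cases hyx : y = x <;> by_cases hyx' : y' = x
    · rw [hyx, hyx'] at hyy; exact absurd hyy (lt_irrefl _)
    · rw [hyx, Function.update_self, Function.update_of_ne hyx']
      have := hR _ (hmaps y' hy' hyx').1 (hmaps y' hy' hyx').2
      have := hb y' hy'
      cases d <;> simp_all [Blocks]
    · rw [hyx', Function.update_self, Function.update_of_ne hyx]
      have := hR _ (hmaps y hy hyx).1 (hmaps y hy hyx).2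
      have := hb y hy
      cases d <;> simp_all [Blocks]
    · rw [Function.update_of_ne hyx, Function.update_of_ne hyx']
      exact h3 (hmem y hy hyx) (hmem y' hy' hyx') hyy

theorem update_zero_mem_placements [Fintype β] {z : β} (hz : z ∉ S) {R : Finset ℤ} {e : ℤ}
    {x : β} (hxS : x ∈ S) {f : β → ℤ} (hf : f ∈ placements z S R) (hfx : f x = e) :
    Function.update f x 0 ∈ placements z (S.erase x) (R.erase e) := by
  rw [mem_placements] at *
  obtain ⟨h1, h2, h3⟩ := hf
  have hzx : z ≠ x := fun h => hz (h ▸ hxS)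
  have hne : ∀ y, y ∈ insert z ((S.erase x : Finset β) : Set β) → y ≠ x := by
    rintro y (rfl | hy)
    · exact hzx
    · exact (mem_erase.1 hy).1
  have hmem : ∀ y, y ∈ insert z ((S.erase x : Finset β) : Set β) → y ∈ insert z (S : Set β) := by
    rintro y (rfl | hy)
    · exact Set.mem_insert _ _
    · exact Set.mem_insert_of_mem _ (mem_of_mem_erase hy)
  refine ⟨fun y hy => ?_, ⟨fun y hy => ?_, fun y hy y' hy' hyy => ?_, fun r hr => ?_⟩,
    fun y hy y' hy' hyy => ?_⟩
  · by_cases hyx : y = x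
    · simp [hyx]
    · rw [Function.update_of_ne hyx]
      exact h1 y fun h => hy (mem_erase.2 ⟨hyx, h⟩)
  · rw [Function.update_of_ne (hne y hy)]
    refine mem_coe.2 (mem_erase.2 ⟨fun h => hne y hy ?_, h2.mapsTo (hmem y hy)⟩)
    exact h2.injOn (hmem y hy) (Set.mem_insert_of_mem _ hxS) (h.trans hfx.symm)
  · rw [Function.update_of_ne (hne y hy), Function.update_of_ne (hne y' hy')] at hyy
    exact h2.injOn (hmem y hy) (hmem y' hy') hyy
  · have hr' := mem_erase.1 (mem_coe.1 hr)
    obtain ⟨y, hy, rfl⟩ := h2.surjOn (mem_coe.2 hr'.2)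
    have hyx : y ≠ x := fun h => hr'.1 (h ▸ hfx)
    refine ⟨y, ?_, Function.update_of_ne hyx _ _⟩
    simpa [hyx] using hy
  · rw [Function.update_of_ne (hne y hy), Function.update_of_ne (hne y' hy')]
    exact h3 (hmem y hy) (hmem y' hy') hyy

theorem not_blocks_of_mem_placements [Fintype β] {z : β} {R : Finset ℤ} {e : ℤ}
    {d : Bool} (hR : IsExtremeIn d R e) {x : β} (hxS : x ∈ S)
    {f : β → ℤ} (hf : f ∈ placements z S R) (hfx : f x = e) :
    ∀ y ∈ insert z (S : Set β), ¬ Blocks (x, d) y := by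
  obtain ⟨-, h2, h3⟩ := mem_placements.1 hf
  intro y hy hb
  have hxm : x ∈ insert z (S : Set β) := Set.mem_insert_of_mem _ hxS
  have hyx : y ≠ x := by rintro rfl; cases d <;> simp [Blocks] at hb
  have h4 := hR (f y) (h2.mapsTo hy) fun h => hyx (h2.injOn hy hxm (h.trans hfx.symm))
  rw [← hfx] at h4
  cases d
  · exact lt_asymm h4 (h3 hy hxm hb)
  · exact lt_asymm h4 (h3 hxm hy hb)

theorem card_placements_filter [Fintype β] {z : β} (hz : z ∉ S) {R : Finset ℤ} {e : ℤ}
    (he : e ∈ R) {d : Bool} (hR : IsExtremeIn d R e) {x : β} (hxS : x ∈ S) :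
    #{f ∈ placements z S R | f x = e} =
      if (x, d) ∈ avail S ∧ ¬ Blocks (x, d) z then
        #(placements z (S.erase x) (R.erase e)) else 0 := by
  split_ifs with h
  · refine card_nbij' (fun f => Function.update f x 0) (fun f => Function.update f x e) ?_ ?_ ?_ ?_
    · intro f hf
      have hf' := mem_filter.1 hf
      exact update_zero_mem_placements hz hxS hf'.1 hf'.2
    · intro f hf
      exact mem_filter.2 ⟨update_mem_placements hz he hR h.1 h.2 hf, by simp⟩
    · intro f hf
      have hf' := mem_filter.1 hf
      simp [← hf'.2]
    · intro f hf
      have := (mem_placements.1 hf).1 x (by simp)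
      simp [← this]
  · rw [card_eq_zero, filter_eq_empty_iff]
    intro f hf hfx
    have hb := not_blocks_of_mem_placements hR hxS hf hfx
    exact h ⟨mem_avail.2 ⟨hxS, fun y hy => hb y (Set.mem_insert_of_mem _ hy)⟩,
      hb z (Set.mem_insert _ _)⟩

theorem card_placements_eq_sum [Fintype β] {z : β} {R : Finset ℤ} {e : ℤ}
    (he : e ∈ R) (he0 : e ≠ 0) :
    #(placements z S R) = ∑ x ∈ S, #{f ∈ placements z S R | f x = e} := by
  simp only [card_filter]
  rw [Finset.sum_comm, card_eq_sum_ones]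
  refine Finset.sum_congr rfl fun f hf => ?_
  obtain ⟨h1, h2, -⟩ := mem_placements.1 hf
  obtain ⟨x, hx, hfx⟩ := h2.surjOn (mem_coe.2 he)
  have hxS : x ∈ S := by
    by_contra h
    exact he0 (hfx.symm.trans (h1 x h))
  rw [Finset.sum_eq_single x, if_pos hfx]
  · intro y hy hyx
    exact if_neg fun h => hyx (h2.injOn (Set.mem_insert_of_mem _ hy) hx (h.trans hfx.symm))
  · exact fun h => absurd hxS h

theorem sum_avail_dirWeight_zero (z : β) (d : Bool) (F : β → ℝ) :
    ∑ i ∈ avail S, moveWeight z 0 i * dirWeight 0 d i.2 * F i.1 =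
      ∑ x ∈ S, if (x, d) ∈ avail S ∧ ¬ Blocks (x, d) z then F x else 0 := by
  have h1 : avail S = (S ×ˢ (Finset.univ : Finset Bool)).filter fun i => i ∈ avail S := by
    ext i
    simp only [mem_filter, mem_product, mem_univ, and_true]
    exact ⟨fun h => ⟨(mem_avail.1 h).1, h⟩, fun h => h.2⟩
  conv_lhs => rw [h1, Finset.sum_filter, Finset.sum_product]
  refine Finset.sum_congr rfl fun x _ => ?_
  rw [Finset.sum_eq_single d]
  · by_cases h : (x, d) ∈ avail S <;> by_cases h' : Blocks (x, d) z <;>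
      simp [moveWeight, dirWeight, h, h']
  · intro b _ hb
    simp [dirWeight, hb]
  · simp

theorem removalSum_eq_card_placements [Fintype β] (z : β) (hz : z ∉ S) (D : List Bool)
    (hS : #S = D.length) :
    removalSum (moveWeight z 0) (D.map (dirWeight 0)) S =
      #(placements z S (Finset.Icc (-(D.count false : ℤ)) (D.count true))) := by
  induction D generalizing S with
  | nil =>
    have hS0 : S = ∅ := by simpa using hS
    subst hS0
    have : placements z ∅ (Finset.Icc (-(([] : List Bool).count false : ℤ))
        (([] : List Bool).count true)) = {0} := by
      ext f
      simp only [mem_placements, mem_singleton]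
      constructor
      · rintro ⟨h, -⟩
        ext x; exact h x (by simp)
      · rintro rfl
        simp [Set.BijOn, Set.MapsTo, Set.InjOn, Set.SurjOn, StrictMonoOn]
    rw [this]; simp [removalSum]
  | cons d D ih =>
    obtain ⟨e, he, he0, hR, hRe⟩ :
        ∃ e ∈ Finset.Icc (-((d :: D).count false : ℤ)) ((d :: D).count true),
        e ≠ 0 ∧ IsExtremeIn d (Finset.Icc (-((d :: D).count false : ℤ)) ((d :: D).count true)) e ∧
        (Finset.Icc (-((d :: D).count false : ℤ)) ((d :: D).count true : ℤ)).erase e =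
          Finset.Icc (-(D.count false : ℤ)) (D.count true) := by
      cases d
      · refine ⟨-(D.count false : ℤ) - 1, ?_, by omega, ?_, ?_⟩
        · simp; omega
        · intro r hr hre
          simp at hr ⊢
          omega
        · ext r
          simp
          omega
      · refine ⟨(D.count true : ℤ) + 1, ?_, by omega, ?_, ?_⟩
        · simp; omega
        · intro r hr hre
          simp at hr ⊢
          omega
        · ext r
          simp only [mem_erase, Finset.mem_Icc, List.count_cons]
          simp
          omega
    rw [card_placements_eq_sum he he0, List.map_cons, removalSum, sum_avail_dirWeight_zero z d
      (fun x => removalSum (moveWeight z 0) (D.map (dirWeight 0)) (S.erase x)), Nat.cast_sum]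
    refine Finset.sum_congr rfl fun x hx => ?_
    rw [card_placements_filter hz he hR hx, hRe, ih (fun h => hz (mem_of_mem_erase h))
      (by rw [card_erase_of_mem hx, hS]; rfl)]
    split_ifs <;> simp

theorem card_linExt_val_eq [Fintype β] (z : β) (k : ℕ) (hk : 1 ≤ k) (hk' : k ≤ Fintype.card β) :
    Nat.card {f : LinExt β // (val f z : ℤ) = k} =
      #(placements z (Finset.univ.erase z)
        (Finset.Icc (-((k - 1 : ℕ) : ℤ)) ((Fintype.card β - k : ℕ) : ℤ))) := by
  have huniv : insert z ((Finset.univ.erase z : Finset β) : Set β) = Set.univ := by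
    ext y; simp
  have key : ∀ g : β → ℤ, g ∈ placements z (Finset.univ.erase z)
      (Finset.Icc (-((k - 1 : ℕ) : ℤ)) ((Fintype.card β - k : ℕ) : ℤ)) ↔
      g z = 0 ∧ Set.BijOn g Set.univ (Set.Icc (1 - (k : ℤ)) (Fintype.card β - k)) ∧
        StrictMono g := by
    intro g
    rw [mem_placements, huniv, strictMonoOn_univ, coe_Icc, Nat.cast_sub hk, Nat.cast_sub hk',
      Nat.cast_one, neg_sub]
    simp
  have hval : ∀ f : LinExt β, (val f z : ℤ) = ((f.1 z : ℕ) : ℤ) + 1 := fun f => by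
    rw [_root_.val]; push_cast; rfl
  rw [← Fintype.card_coe, ← Nat.card_eq_fintype_card]
  refine Nat.card_eq_of_bijective
    (fun f => ⟨fun y => ((f.1.1 y : ℕ) : ℤ) + 1 - k, (key _).2 ⟨?_, ⟨?_, ?_, ?_⟩, ?_⟩⟩) ⟨?_, ?_⟩
  · have := f.2
    rw [hval] at this
    omega
  · intro y _
    have := (f.1.1 y).2
    simp only [Set.mem_Icc]
    omega
  · intro y _ y' _ h
    refine f.1.1.injective (Fin.ext ?_)
    simp only at h
    omega
  · intro r hr
    simp only [Set.mem_Icc] at hr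
    refine ⟨f.1.1.symm ⟨(r + k - 1).toNat, by omega⟩, Set.mem_univ _, ?_⟩
    simp only [Equiv.apply_symm_apply]
    omega
  · intro y y' h
    have := f.1.2 y y' h
    rw [Fin.lt_def] at this
    simp only
    omega
  · intro f f' h
    refine Subtype.ext (Subtype.ext (Equiv.ext fun y => Fin.ext ?_))
    have := congrFun (congrArg Subtype.val h) y
    simp only at this
    omega
  · rintro ⟨g, hg⟩
    obtain ⟨h1, h2, h3⟩ := (key g).1 hg
    have hr : ∀ y, 1 - (k : ℤ) ≤ g y ∧ g y ≤ Fintype.card β - k := fun y =>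
      h2.mapsTo (Set.mem_univ y)
    let F : β → Fin (Fintype.card β) := fun y =>
      ⟨(g y + k - 1).toNat, by have := hr y; omega⟩
    have hF : ∀ y, ((F y : ℕ) : ℤ) = g y + k - 1 := fun y => by
      have := hr y
      simp only [F]; omega
    have hFinj : Function.Injective F := fun y y' h => by
      refine h2.injOn (Set.mem_univ y) (Set.mem_univ y') ?_
      have := hF y
      rw [h, hF y'] at this
      omega
    have hFbij : Function.Bijective F :=
      (Fintype.bijective_iff_injective_and_card F).2 ⟨hFinj, by simp⟩
    refine ⟨⟨⟨Equiv.ofBijective F hFbij, fun y y' h => ?_⟩, ?_⟩, ?_⟩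
    · have := h3 h
      have := hF y
      have := hF y'
      rw [Equiv.ofBijective_apply, Equiv.ofBijective_apply, Fin.lt_def]
      omega
    · refine (hval _).trans ?_
      have := hF z
      rw [h1] at this
      change ((F z : ℕ) : ℤ) + 1 = k
      omega
    · refine Subtype.ext (funext fun y => ?_)
      simp only [Equiv.ofBijective_apply, hF]
      omega

theorem card_linExt_val_mul_le [Fintype β] (z : β) (k : ℕ) (hk : 2 ≤ k)
    (hk' : k + 1 ≤ Fintype.card β) :
    (Nat.card {f : LinExt β // (val f z : ℤ) = (k - 1 : ℕ)} : ℝ) *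
      Nat.card {f : LinExt β // (val f z : ℤ) = (k + 1 : ℕ)} ≤
      (Nat.card {f : LinExt β // (val f z : ℤ) = k} : ℝ) ^ 2 := by
  let D := List.replicate (k - 2) false ++ List.replicate (Fintype.card β - 1 - k) true
  have hS : #(Finset.univ.erase z) = D.length + 2 := by
    rw [card_erase_of_mem (mem_univ _), card_univ]
    simp only [D, List.length_append, List.length_replicate]
    omega
  have hf : D.count false = k - 2 := by simp [D, List.count_replicate]
  have ht : D.count true = Fintype.card β - 1 - k := by simp [D, List.count_replicate]
  have hz : z ∉ Finset.univ.erase z := by simp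
  have h := removalSum_dirWeight_zero_mul_le z D hS
  rw [removalSum_eq_card_placements z hz _ (by simpa using hS),
    removalSum_eq_card_placements z hz _ (by simpa using hS),
    removalSum_eq_card_placements z hz _ (by simpa using hS)] at h
  simp only [List.count_cons, hf, ht] at h
  rw [card_linExt_val_eq z (k - 1) (by omega) (by omega),
    card_linExt_val_eq z (k + 1) (by omega) (by omega),
    card_linExt_val_eq z k (by omega) (by omega), mul_comm]
  convert h using 7 <;> simp <;> omega

end Atlas

/-- Stanley's theorem: for every finite poset `P`, `x ∈ P` and integer `k`,
`ℙ(f(x) = k)² ≥ ℙ(f(x) = k-1) · ℙ(f(x) = k+1)`. -/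
theorem stmt_8 (β : Type) [Fintype β] [PartialOrder β] (x : β) (k : ℤ) :
    Pr (fun f : LinExt β => (val f x : ℤ) = k - 1) *
      Pr (fun f : LinExt β => (val f x : ℤ) = k + 1) ≤
    Pr (fun f : LinExt β => (val f x : ℤ) = k) ^ 2 := by
  by_cases hk : 2 ≤ k ∧ k + 1 ≤ Fintype.card β
  · obtain ⟨m, rfl⟩ : ∃ m : ℕ, k = m := ⟨k.toNat, by omega⟩
    have h := card_linExt_val_mul_le x m (by omega) (by omega)
    rw [Nat.cast_sub (by omega)] at h
    push_cast at h
    simp only [Pr]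
    rw [div_mul_div_comm, div_pow, ← pow_two]
    exact div_le_div_of_nonneg_right h (sq_nonneg _)
  · have h0 : ∀ j : ℤ, (∀ f : LinExt β, (val f x : ℤ) ≠ j) →
        Pr (fun f : LinExt β => (val f x : ℤ) = j) = 0 := fun j hj => by
      have : IsEmpty {f : LinExt β // (val f x : ℤ) = j} := ⟨fun f => hj f.1 f.2⟩
      simp [Pr]
    have hv : ∀ f : LinExt β, 1 ≤ (val f x : ℤ) ∧ (val f x : ℤ) ≤ Fintype.card β := fun f => by
      have := (f.1 x).2
      rw [_root_.val]
      omega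
    have : Pr (fun f : LinExt β => (val f x : ℤ) = k - 1) *
        Pr (fun f : LinExt β => (val f x : ℤ) = k + 1) = 0 := by
      by_cases h2 : 2 ≤ k
      · rw [h0 (k + 1) fun f => by have := hv f; omega, mul_zero]
      · rw [h0 (k - 1) fun f => by have := hv f; omega, zero_mul]
    rw [this]
    exact sq_nonneg _
end

section
/- There is a universal constant C > 0 such that: every integer-valued random variable f with finite support, whose distribution p_k = ℙ(f = k) is log-concave (i.e. the support {k : p_k > 0} is a set of consecutive integers and p_k² ≥ p_{k−1} p_{k+1} for all integers k), satisfies Var(f) ≤ C · (max_k p_k)^{−2}. -/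
open Finset

/-- A log-concave sequence without internal zeros has nonincreasing successive ratios. -/
lemma logConcave_mul_succ_le {a : ℕ → ℝ} (h0 : ∀ n, 0 ≤ a n)
    (hI : ∀ i j k, i ≤ j → j ≤ k → 0 < a i → 0 < a k → 0 < a j)
    (hL : ∀ n, a n * a (n + 2) ≤ a (n + 1) ^ 2) {i j : ℕ} (hji : j ≤ i) :
    a (i + 1) * a j ≤ a i * a (j + 1) := by
  induction i, hji using Nat.le_induction with
  | base => rw [mul_comm]
  | succ i hji ih =>
    have hR : 0 ≤ a (i + 1) * a (j + 1) := mul_nonneg (h0 _) (h0 _)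
    rcases (h0 j).eq_or_lt with hj | hj
    · simpa [← hj] using hR
    rcases (h0 (i + 2)).eq_or_lt with h2 | h2
    · simpa [← h2] using hR
    have hi : 0 < a i := hI j i (i + 2) hji (by lia) hj h2
    refine le_of_mul_le_mul_left ?_ hi
    calc a i * (a (i + 1 + 1) * a j) = (a i * a (i + 2)) * a j := by ring
      _ ≤ a (i + 1) ^ 2 * a j := mul_le_mul_of_nonneg_right (hL i) hj.le
      _ = a (i + 1) * (a (i + 1) * a j) := by ring
      _ ≤ a (i + 1) * (a i * a (j + 1)) := mul_le_mul_of_nonneg_left ih (h0 _)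
      _ = a i * (a (i + 1) * a (j + 1)) := by ring

/-- A log-concave sequence without internal zeros, divided by its value at `0`, is
submultiplicative. -/
lemma logConcave_zero_mul_add_le {a : ℕ → ℝ} (h0 : ∀ n, 0 ≤ a n)
    (hI : ∀ i j k, i ≤ j → j ≤ k → 0 < a i → 0 < a k → 0 < a j)
    (hL : ∀ n, a n * a (n + 2) ≤ a (n + 1) ^ 2) (i j : ℕ) :
    a 0 * a (i + j) ≤ a i * a j := by
  induction j with
  | zero => simp [mul_comm]
  | succ j ih =>
    have hR : 0 ≤ a i * a (j + 1) := mul_nonneg (h0 _) (h0 _)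
    rcases (h0 0).eq_or_lt with hz | hz
    · simpa [← hz] using hR
    rcases (h0 (i + (j + 1))).eq_or_lt with h2 | h2
    · simpa [← h2] using hR
    have hj : 0 < a j := hI 0 j (i + (j + 1)) (by lia) (by lia) hz h2
    refine le_of_mul_le_mul_left ?_ hj
    calc a j * (a 0 * a (i + (j + 1))) = a 0 * (a (i + j + 1) * a j) := by
          rw [add_assoc]; ring
      _ ≤ a 0 * (a (i + j) * a (j + 1)) :=
          mul_le_mul_of_nonneg_left (logConcave_mul_succ_le h0 hI hL (by lia)) hz.le
      _ = (a 0 * a (i + j)) * a (j + 1) := by ring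
      _ ≤ (a i * a j) * a (j + 1) := mul_le_mul_of_nonneg_right ih (h0 _)
      _ = a j * (a i * a (j + 1)) := by ring

lemma mul_sum_partialSum_mul_le {a F : ℕ → ℝ} (h0 : ∀ n, 0 ≤ a n) (hF : ∀ n, 0 ≤ F n)
    (hsub : ∀ i j, a 0 * a (i + j) ≤ a i * a j) (N : ℕ) :
    a 0 * ∑ n ∈ range N, (∑ i ∈ range (n + 1), F i) * a n ≤
      (∑ i ∈ range N, F i * a i) * ∑ j ∈ range N, a j := by
  calc a 0 * ∑ n ∈ range N, (∑ i ∈ range (n + 1), F i) * a n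
      = ∑ n ∈ range N, ∑ i ∈ range (n + 1), F i * (a 0 * a n) := by
        rw [mul_sum]
        refine sum_congr rfl fun n _ => ?_
        rw [← sum_mul]; ring
    _ ≤ ∑ n ∈ range N, ∑ i ∈ range (n + 1), F i * a i * a (n - i) := by
        refine sum_le_sum fun n _ => sum_le_sum fun i hi => ?_
        have h := hsub i (n - i)
        rw [Nat.add_sub_cancel' (by simpa [Nat.lt_succ_iff] using hi)] at h
        rw [mul_assoc]
        exact mul_le_mul_of_nonneg_left h (hF i)
    _ = ∑ i ∈ range N, ∑ j ∈ range (N - i), F i * a i * a j :=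
        sum_range_diag_flip N fun i j => F i * a i * a j
    _ ≤ ∑ i ∈ range N, ∑ j ∈ range N, F i * a i * a j :=
        sum_le_sum fun i _ => sum_le_sum_of_subset_of_nonneg
          (range_subset_range.2 (Nat.sub_le _ _))
          fun j _ _ => mul_nonneg (mul_nonneg (hF i) (h0 i)) (h0 j)
    _ = (∑ i ∈ range N, F i * a i) * ∑ j ∈ range N, a j := (sum_mul_sum _ _ _ _).symm

/-- Second moment bound for a log-concave sequence of total mass at most `1`. -/
lemma logConcave_sum_sq_mul_le {a : ℕ → ℝ} (h0 : ∀ n, 0 ≤ a n)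
    (hI : ∀ i j k, i ≤ j → j ≤ k → 0 < a i → 0 < a k → 0 < a j)
    (hL : ∀ n, a n * a (n + 2) ≤ a (n + 1) ^ 2) (hpos : 0 < a 0) {N : ℕ}
    (hsum : ∑ n ∈ range N, a n ≤ 1) :
    ∑ n ∈ range N, (n : ℝ) ^ 2 * a n ≤ 2 / a 0 ^ 2 := by
  have hsub := logConcave_zero_mul_add_le h0 hI hL
  have hS : 0 ≤ ∑ n ∈ range N, a n := sum_nonneg fun n _ => h0 n
  have h1 := mul_sum_partialSum_mul_le (F := fun _ => 1) h0 (fun _ => zero_le_one) hsub N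
  have h2 := mul_sum_partialSum_mul_le (F := fun n => (n : ℝ) + 1) h0
    (fun n => by positivity) hsub N
  have hc : ∀ n : ℕ, ∑ i ∈ range (n + 1), ((i : ℝ) + 1) = (n + 1) * (n + 2) / 2 := by
    intro n
    induction n with
    | zero => norm_num
    | succ n ih => rw [sum_range_succ, ih]; push_cast; ring
  simp only [sum_const, card_range, nsmul_eq_mul, mul_one, one_mul, Nat.cast_add,
    Nat.cast_one] at h1
  simp only [hc] at h2
  set A := ∑ n ∈ range N, ((n : ℝ) + 1) * a n
  set B := ∑ n ∈ range N, ((n : ℝ) + 1) * (n + 2) / 2 * a n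
  have hA : 0 ≤ A := sum_nonneg fun n _ => mul_nonneg (by positivity) (h0 n)
  have hB : a 0 ^ 2 * B ≤ 1 := by
    calc a 0 ^ 2 * B = a 0 * (a 0 * B) := by ring
      _ ≤ a 0 * A := by
        refine mul_le_mul_of_nonneg_left (h2.trans ?_) hpos.le
        exact mul_le_of_le_one_right hA hsum
      _ ≤ 1 := h1.trans (mul_le_one₀ hsum hS hsum)
  have hQ : ∑ n ∈ range N, (n : ℝ) ^ 2 * a n ≤ 2 * B := by
    rw [mul_sum]
    refine sum_le_sum fun n _ => ?_
    rw [← mul_assoc]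
    refine mul_le_mul_of_nonneg_right ?_ (h0 n)
    have : (0 : ℝ) ≤ n := n.cast_nonneg
    linarith [sq (n : ℝ)]
  rw [le_div_iff₀ (by positivity)]
  nlinarith [mul_le_mul_of_nonneg_left hQ (sq_nonneg (a 0))]

lemma sum_comp_le_sum_support {ι κ : Type*} {p : κ → ℝ} (hfin : (Function.support p).Finite)
    (h0 : ∀ k, 0 ≤ p k) {e : ι → κ} (he : Function.Injective e) (t : Finset ι) :
    ∑ n ∈ t, p (e n) ≤ ∑ k ∈ hfin.toFinset, p k := by
  classical
  rw [← sum_image (f := p) he.injOn, ← sum_filter_ne_zero]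
  exact sum_le_sum_of_subset_of_nonneg (fun x hx => by simpa using (mem_filter.1 hx).2)
    fun k _ _ => h0 k

lemma sum_int_le_sum_range_add_sum_range {g : ℤ → ℝ} (hg : ∀ k, 0 ≤ g k) (s : Finset ℤ)
    (m : ℤ) : ∃ N : ℕ, ∑ k ∈ s, g k ≤
      ∑ n ∈ range N, g (m + n) + ∑ n ∈ range N, g (m - n) := by
  refine ⟨s.sup (fun k => (k - m).natAbs) + 1, ?_⟩
  set N := s.sup (fun k => (k - m).natAbs) + 1
  have hN : ∀ k ∈ s, (k - m).natAbs < N := fun k hk =>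
    Nat.lt_succ_of_le (le_sup (f := fun k => (k - m).natAbs) hk)
  rw [← sum_image (f := g) (s := range N) (g := fun n : ℕ => m + n)
      (fun x _ y _ h => by simpa using h),
    ← sum_image (f := g) (s := range N) (g := fun n : ℕ => m - n)
      (fun x _ y _ h => by simpa using h),
    ← sum_filter_add_sum_filter_not s (fun k => m ≤ k)]
  refine add_le_add (sum_le_sum_of_subset_of_nonneg ?_ fun k _ _ => hg k)
    (sum_le_sum_of_subset_of_nonneg ?_ fun k _ _ => hg k)
  all_goals
    intro k hk
    obtain ⟨hks, hmk⟩ := mem_filter.1 hk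
    exact mem_image.2 ⟨(k - m).natAbs, mem_range.2 (hN k hks), by lia⟩

/-- there is a universal constant `C > 0` such that every finitely supported
log-concave probability distribution `p` on `ℤ` (support an interval of integers, and
`p_k² ≥ p_{k-1} p_{k+1}`) satisfies `Var ≤ C · (max_k p_k)⁻²`. -/
theorem stmt_9 :
    ∃ C : ℝ, 0 < C ∧
      ∀ (p : ℤ → ℝ) (hfin : (Function.support p).Finite),
        (∀ k : ℤ, 0 ≤ p k) →
        (∑ k ∈ hfin.toFinset, p k = 1) →
        (∀ a b c : ℤ, a ≤ b → b ≤ c → 0 < p a → 0 < p c → 0 < p b) →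
        (∀ k : ℤ, p (k - 1) * p (k + 1) ≤ p k ^ 2) →
        ∀ M : ℝ, (∀ k : ℤ, p k ≤ M) → (∃ k : ℤ, p k = M) →
          (∑ k ∈ hfin.toFinset, (k : ℝ) ^ 2 * p k) -
              (∑ k ∈ hfin.toFinset, (k : ℝ) * p k) ^ 2 ≤ C / M ^ 2 := by
  refine ⟨4, by norm_num, ?_⟩
  rintro p hfin h0 hsum hI hL M hM ⟨m, hm⟩
  have hpos : 0 < p m := by
    rw [hm]
    by_contra! hM0
    have : ∑ k ∈ hfin.toFinset, p k ≤ 0 := sum_nonpos fun k _ => (hM k).trans hM0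
    linarith
  have hright (N : ℕ) : ∑ n ∈ range N, (n : ℝ) ^ 2 * p (m + n) ≤ 2 / M ^ 2 := by
    have := logConcave_sum_sq_mul_le (a := fun n : ℕ => p (m + n)) (N := N) (fun n => h0 _)
      (fun i j k hij hjk => hI _ _ _ (by lia) (by lia))
      (fun n => by
        convert hL (m + n + 1) using 3 <;> push_cast <;> ring_nf)
      (by simpa using hpos)
      ((sum_comp_le_sum_support hfin h0 (fun x y h => by simpa using h) _).trans hsum.le)
    simpa [hm] using this
  have hleft (N : ℕ) : ∑ n ∈ range N, (n : ℝ) ^ 2 * p (m - n) ≤ 2 / M ^ 2 := by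
    have := logConcave_sum_sq_mul_le (a := fun n : ℕ => p (m - n)) (N := N) (fun n => h0 _)
      (fun i j k hij hjk hi hk => hI _ _ _ (by lia) (by lia) hk hi)
      (fun n => by
        rw [mul_comm]
        convert hL (m - n - 1) using 3 <;> push_cast <;> ring_nf)
      (by simpa using hpos)
      ((sum_comp_le_sum_support hfin h0 (fun x y h => by simpa using h) _).trans hsum.le)
    simpa [hm] using this
  obtain ⟨N, hN⟩ := sum_int_le_sum_range_add_sum_range (g := fun k => ((k : ℝ) - m) ^ 2 * p k)
    (fun k => mul_nonneg (sq_nonneg _) (h0 k)) hfin.toFinset m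
  have hexp : ∑ k ∈ hfin.toFinset, ((k : ℝ) - m) ^ 2 * p k =
      ∑ k ∈ hfin.toFinset, (k : ℝ) ^ 2 * p k - 2 * m * ∑ k ∈ hfin.toFinset, (k : ℝ) * p k
        + (m : ℝ) ^ 2 := by
    rw [← mul_one ((m : ℝ) ^ 2), ← hsum, mul_sum, mul_sum, ← sum_sub_distrib, ← sum_add_distrib]
    exact sum_congr rfl fun k _ => by ring
  simp only [Int.cast_add, Int.cast_sub, Int.cast_natCast, add_sub_cancel_left, sub_sub_cancel_left,
    neg_sq] at hN
  have hM4 : 4 / M ^ 2 = 2 / M ^ 2 + 2 / M ^ 2 := by ring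
  linarith [hright N, hleft N, sq_nonneg (∑ k ∈ hfin.toFinset, (k : ℝ) * p k - m)]
end

section
/- For every positive integer w and every ε > 0 there exists δ₀ > 0 such that: for every finite poset P of width at most w and every x ∈ P with q(x) ≤ δ₀, one has δ_x > 1/2 − ε. -/
open Finset

section
open scoped FinsetFamily Classical

/-- Order-preserving maps `F` to `Fin N` with `F y < F x` on `S` and `F x ≤ F y` on `T`. -/
noncomputable def orderMaps {β : Type} [Fintype β] [PartialOrder β] (x : β) (S T : Finset β) (N : ℕ) :
    Finset (β → Fin N) :=
  univ.filter fun F => (∀ a b, a < b → F a ≤ F b) ∧ (∀ y ∈ S, F y < F x) ∧ ∀ y ∈ T, F x ≤ F y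

/-- The coordinates `(-F x, (F y - F x)_{y ≠ x})`, in which the pointwise order on maps makes the
sets `orderMaps x S T N` compatible with meets and joins. -/
noncomputable def shear {β : Type} (x : β) {N : ℕ} (F : β → Fin N) : β → ℤ :=
  fun y => if y = x then -((F x : ℕ) : ℤ) else ((F y : ℕ) : ℤ) - (F x : ℕ)

variable {β : Type} {x : β} {N : ℕ}

theorem shear_injective : Function.Injective (shear x (N := N)) := by
  intro F G h
  have hx := congrFun h x
  simp only [shear, if_true] at hx
  funext y
  by_cases hy : y = x
  · subst hy; apply Fin.ext; omega
  · have := congrFun h y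
    simp only [shear, hy, if_false] at this
    apply Fin.ext; omega

variable [Fintype β] [PartialOrder β]

theorem exists_shear_inf {S T S' T' : Finset β} {F G : β → Fin N}
    (hF : F ∈ orderMaps x S T N) (hG : G ∈ orderMaps x S' T' N) :
    ∃ H ∈ orderMaps x (S ∪ S') (T ∩ T') N, shear x H = shear x F ⊓ shear x G := by
  simp only [orderMaps, mem_filter, mem_univ, true_and] at hF hG ⊢
  obtain ⟨hF1, hF2, hF3⟩ := hF
  obtain ⟨hG1, hG2, hG3⟩ := hG
  let H : β → Fin N := fun y => ⟨(min (((F y : ℕ) : ℤ) - (F x : ℕ)) (((G y : ℕ) : ℤ) - (G x : ℕ)) +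
    max ((F x : ℕ) : ℤ) (G x : ℕ)).toNat, by
      have := (F y).2; have := (G y).2; omega⟩
  have hH : ∀ y, ((H y : ℕ) : ℤ) =
      min (((F y : ℕ) : ℤ) - (F x : ℕ)) (((G y : ℕ) : ℤ) - (G x : ℕ)) +
        max ((F x : ℕ) : ℤ) (G x : ℕ) := by
    intro y; simp only [H]; omega
  refine ⟨H, ⟨fun a b hab => ?_, fun y hy => ?_, fun y hy => ?_⟩, ?_⟩
  · have h1 := Fin.le_def.1 (hF1 a b hab)
    have h2 := Fin.le_def.1 (hG1 a b hab)
    have := hH a; have := hH b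
    rw [Fin.le_def]; omega
  · have := hH y; have := hH x
    rw [Fin.lt_def]
    rcases mem_union.1 hy with hy | hy
    · have := Fin.lt_def.1 (hF2 y hy); omega
    · have := Fin.lt_def.1 (hG2 y hy); omega
  · have := hH y; have := hH x
    have := Fin.le_def.1 (hF3 y (mem_inter.1 hy).1)
    have := Fin.le_def.1 (hG3 y (mem_inter.1 hy).2)
    rw [Fin.le_def]; omega
  · funext y
    have := hH y; have := hH x
    simp only [shear, Pi.inf_apply]
    split_ifs <;> omega

theorem exists_shear_sup {S T S' T' : Finset β} {F G : β → Fin N}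
    (hF : F ∈ orderMaps x S T N) (hG : G ∈ orderMaps x S' T' N) :
    ∃ H ∈ orderMaps x (S ∩ S') (T ∪ T') N, shear x H = shear x F ⊔ shear x G := by
  simp only [orderMaps, mem_filter, mem_univ, true_and] at hF hG ⊢
  obtain ⟨hF1, hF2, hF3⟩ := hF
  obtain ⟨hG1, hG2, hG3⟩ := hG
  let H : β → Fin N := fun y => ⟨(max (((F y : ℕ) : ℤ) - (F x : ℕ)) (((G y : ℕ) : ℤ) - (G x : ℕ)) +
    min ((F x : ℕ) : ℤ) (G x : ℕ)).toNat, by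
      have := (F y).2; have := (G y).2; omega⟩
  have hH : ∀ y, ((H y : ℕ) : ℤ) =
      max (((F y : ℕ) : ℤ) - (F x : ℕ)) (((G y : ℕ) : ℤ) - (G x : ℕ)) +
        min ((F x : ℕ) : ℤ) (G x : ℕ) := by
    intro y; simp only [H]; omega
  refine ⟨H, ⟨fun a b hab => ?_, fun y hy => ?_, fun y hy => ?_⟩, ?_⟩
  · have h1 := Fin.le_def.1 (hF1 a b hab)
    have h2 := Fin.le_def.1 (hG1 a b hab)
    have := hH a; have := hH b
    rw [Fin.le_def]; omega
  · have := hH y; have := hH x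
    have := Fin.lt_def.1 (hF2 y (mem_inter.1 hy).1)
    have := Fin.lt_def.1 (hG2 y (mem_inter.1 hy).2)
    rw [Fin.lt_def]; omega
  · have := hH y; have := hH x
    rw [Fin.le_def]
    rcases mem_union.1 hy with hy | hy
    · have := Fin.le_def.1 (hF3 y hy); omega
    · have := Fin.le_def.1 (hG3 y hy); omega
  · funext y
    have := hH y; have := hH x
    simp only [shear, Pi.sup_apply]
    split_ifs <;> omega

theorem card_orderMaps_mul_le (S T S' T' : Finset β) (N : ℕ) :
    #(orderMaps x S T N) * #(orderMaps x S' T' N) ≤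
      #(orderMaps x (S ∪ S') (T ∩ T') N) * #(orderMaps x (S ∩ S') (T ∪ T') N) := by
  have key := Finset.le_card_infs_mul_card_sups ((orderMaps x S T N).image (shear x))
    ((orderMaps x S' T' N).image (shear x))
  rw [card_image_of_injective _ shear_injective, card_image_of_injective _ shear_injective] at key
  refine key.trans (Nat.mul_le_mul ?_ ?_)
  · refine le_trans (card_le_card ?_) (card_image_le (f := shear x))
    intro p hp
    obtain ⟨a, ha, b, hb, rfl⟩ := mem_infs.1 hp
    obtain ⟨F, hF, rfl⟩ := mem_image.1 ha
    obtain ⟨G, hG, rfl⟩ := mem_image.1 hb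
    obtain ⟨H, hH, h⟩ := exists_shear_inf hF hG
    exact mem_image.2 ⟨H, hH, h⟩
  · refine le_trans (card_le_card ?_) (card_image_le (f := shear x))
    intro p hp
    obtain ⟨a, ha, b, hb, rfl⟩ := mem_sups.1 hp
    obtain ⟨F, hF, rfl⟩ := mem_image.1 ha
    obtain ⟨G, hG, rfl⟩ := mem_image.1 hb
    obtain ⟨H, hH, h⟩ := exists_shear_sup hF hG
    exact mem_image.2 ⟨H, hH, h⟩

/-- Linear extensions placing all of `S` before `x` and none of `T` before `x`. -/
noncomputable def linExts (x : β) (S T : Finset β) : Finset (LinExt β) :=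
  univ.filter fun f => (∀ y ∈ S, f.1 y < f.1 x) ∧ ∀ y ∈ T, f.1 x ≤ f.1 y

theorem card_linExts_mul_le_card_orderMaps (S T : Finset β) (N : ℕ) :
    #(linExts x S T) * Fintype.card (Fin (Fintype.card β) ↪o Fin N) ≤ #(orderMaps x S T N) := by
  rw [← card_univ, ← card_product]
  refine card_le_card_of_injOn (fun p y => p.2 (p.1.1 y)) ?_ ?_
  · rintro ⟨f, o⟩ hp
    have hp := (mem_product.1 (mem_coe.1 hp)).1
    simp only [linExts, mem_filter, mem_univ, true_and] at hp
    simp only [orderMaps, coe_filter, mem_univ, true_and, Set.mem_ofPred_eq]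
    exact ⟨fun a b hab => o.le_iff_le.2 (f.2 a b hab).le, fun y hy => o.lt_iff_lt.2 (hp.1 y hy),
      fun y hy => o.le_iff_le.2 (hp.2 y hy)⟩
  · rintro ⟨f, o⟩ - ⟨f', o'⟩ - h
    have h' : ∀ y, o (f.1 y) = o' (f'.1 y) := fun y => congrFun h y
    have ho : o = o' := by
      apply RelEmbedding.coe_fn_injective
      refine (o.strictMono.range_inj o'.strictMono).1 ?_
      ext i
      constructor
      · rintro ⟨j, rfl⟩
        exact ⟨f'.1 (f.1.symm j), by rw [← h', Equiv.apply_symm_apply]⟩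
      · rintro ⟨j, rfl⟩
        exact ⟨f.1 (f'.1.symm j), by rw [h', Equiv.apply_symm_apply]⟩
    subst ho
    have : f = f' := Subtype.ext (Equiv.ext fun y => o.injective (h' y))
    rw [this]

/-- An injective map to `Fin N` is a bijection to an initial segment followed by an order
embedding. -/
theorem exists_factorization {β : Type} [Fintype β] {N : ℕ} {F : β → Fin N} (hF : Function.Injective F) :
    ∃ (f : β ≃ Fin (Fintype.card β)) (o : Fin (Fintype.card β) ↪o Fin N), ∀ y, o (f y) = F y := by
  have h : #(univ.image F) = Fintype.card β := by rw [card_image_of_injective _ hF, card_univ]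
  let e := (univ.image F).orderIsoOfFin h
  let g : β → Fin (Fintype.card β) := fun y => e.symm ⟨F y, mem_image_of_mem _ (mem_univ y)⟩
  have hg : Function.Injective g := by
    intro a b hab
    exact hF (congrArg Subtype.val (e.symm.injective hab))
  refine ⟨Equiv.ofBijective g ((Fintype.bijective_iff_injective_and_card g).2 ⟨hg, by simp⟩),
    (univ.image F).orderEmbOfFin h, fun y => ?_⟩
  change ((e (g y) : univ.image F) : Fin N) = F y
  simp [g]

theorem card_orderMaps_le (S T : Finset β) (N : ℕ) :
    #(orderMaps x S T N) ≤ #(linExts x S T) * Fintype.card (Fin (Fintype.card β) ↪o Fin N) +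
      (N ^ Fintype.card β - N.descFactorial (Fintype.card β)) := by
  have hsub : orderMaps x S T N ⊆
      (linExts x S T ×ˢ (univ : Finset (Fin (Fintype.card β) ↪o Fin N))).image
        (fun p y => p.2 (p.1.1 y)) ∪ univ.filter (fun F => ¬ Function.Injective F) := by
    intro F hF
    by_cases hinj : Function.Injective F
    · refine mem_union_left _ ?_
      obtain ⟨f, o, hfo⟩ := exists_factorization hinj
      obtain rfl : (fun y => o (f y)) = F := funext hfo
      simp only [orderMaps, mem_filter, mem_univ, true_and, o.le_iff_le, o.lt_iff_lt] at hF
      refine mem_image.2 ⟨(⟨f, fun a b hab => lt_of_le_of_ne (hF.1 a b hab)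
        (fun h => hab.ne (f.injective h))⟩, o), ?_, rfl⟩
      exact mem_product.2 ⟨mem_filter.2 ⟨mem_univ _, hF.2⟩, mem_univ _⟩
    · exact mem_union_right _ (by simpa using hinj)
  refine (card_le_card hsub).trans ((card_union_le _ _).trans (Nat.add_le_add ?_ (le_of_eq ?_)))
  · refine card_image_le.trans ?_
    rw [card_product, card_univ]
  · have h1 := card_filter_add_card_filter_not (s := (univ : Finset (β → Fin N)))
      (fun F => Function.Injective F)
    have h2 : #(univ.filter fun F : β → Fin N => Function.Injective F) =
        N.descFactorial (Fintype.card β) := by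
      rw [← Fintype.card_subtype, Fintype.card_congr (Equiv.subtypeInjectiveEquivEmbedding _ _),
        Fintype.card_embedding_eq, Fintype.card_fin]
    rw [card_univ, Fintype.card_fun, Fintype.card_fin] at h1
    omega

theorem descFactorial_le (n N : ℕ) :
    N.descFactorial n ≤ n.factorial * Fintype.card (Fin n ↪o Fin N) := by
  have h1 : N.descFactorial n = Fintype.card (Fin n ↪ Fin N) := by
    rw [Fintype.card_embedding_eq, Fintype.card_fin, Fintype.card_fin]
  have h2 : n.factorial = Fintype.card (Fin n ≃ Fin (Fintype.card (Fin n))) := by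
    rw [Fintype.card_equiv (finCongr (Fintype.card_fin n).symm), Fintype.card_fin]
  have h3 : Fintype.card (Fin n ↪o Fin N) =
      Fintype.card (Fin (Fintype.card (Fin n)) ↪o Fin N) := by
    rw [Fintype.card_fin]
  rw [h1, h2, h3, ← Fintype.card_prod]
  refine Fintype.card_le_of_surjective
    (fun p => p.1.toEmbedding.trans p.2.toEmbedding) fun F => ?_
  obtain ⟨f, o, h⟩ := exists_factorization F.injective
  exact ⟨(f, o), DFunLike.ext _ _ h⟩

theorem tendsto_pow_sub_descFactorial_div (n : ℕ) :
    Filter.Tendsto (fun N : ℕ => ((N ^ n - N.descFactorial n : ℕ) : ℝ) /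
      Fintype.card (Fin n ↪o Fin N)) Filter.atTop (nhds 0) := by
  have hbound : Filter.Tendsto (fun N : ℕ => (n.factorial : ℝ) *
      ((N : ℝ) ^ n / (N.descFactorial n : ℝ) - 1)) Filter.atTop (nhds 0) := by
    have h1 : Filter.Tendsto (fun N : ℕ => (N : ℝ) ^ n / (N.descFactorial n : ℝ))
        Filter.atTop (nhds 1) := by
      refine (Asymptotics.isEquivalent_iff_tendsto_one ?_).1 (isEquivalent_descFactorial n).symm
      filter_upwards [Filter.eventually_ge_atTop n] with N hN
      exact_mod_cast (Nat.pos_of_ne_zero fun h =>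
        absurd (Nat.descFactorial_eq_zero_iff_lt.1 h) (by omega)).ne'
    simpa using (h1.sub_const 1).const_mul (n.factorial : ℝ)
  refine squeeze_zero' (Filter.Eventually.of_forall fun N => by positivity) ?_ hbound
  filter_upwards [Filter.eventually_ge_atTop n] with N hN
  have hd : (0 : ℝ) < N.descFactorial n := by
    exact_mod_cast Nat.pos_of_ne_zero fun h =>
      absurd (Nat.descFactorial_eq_zero_iff_lt.1 h) (by omega)
  have hle : (N.descFactorial n : ℝ) ≤ n.factorial * Fintype.card (Fin n ↪o Fin N) := by
    exact_mod_cast descFactorial_le n N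
  have hO : (0 : ℝ) < Fintype.card (Fin n ↪o Fin N) := by
    have : (0 : ℝ) < n.factorial * Fintype.card (Fin n ↪o Fin N) := hd.trans_le hle
    exact pos_of_mul_pos_right this (by positivity)
  have hpow : N.descFactorial n ≤ N ^ n := Nat.descFactorial_le_pow N n
  rw [Nat.cast_sub hpow, Nat.cast_pow, div_sub_one hd.ne', div_le_iff₀ hO]
  have hnn : (0 : ℝ) ≤ (N : ℝ) ^ n - N.descFactorial n := by
    rw [sub_nonneg]; exact_mod_cast hpow
  calc (N : ℝ) ^ n - N.descFactorial n
      = ((N : ℝ) ^ n - N.descFactorial n) / N.descFactorial n * N.descFactorial n := by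
        rw [div_mul_cancel₀ _ hd.ne']
    _ ≤ ((N : ℝ) ^ n - N.descFactorial n) / N.descFactorial n *
          (n.factorial * Fintype.card (Fin n ↪o Fin N)) := by gcongr
    _ = _ := by ring

/-- The random down-set `{y | f y < f x}` of a uniform linear extension `f` satisfies a
log-supermodular correlation inequality. -/
theorem card_linExts_mul_le (S T S' T' : Finset β) :
    #(linExts x S T) * #(linExts x S' T') ≤
      #(linExts x (S ∪ S') (T ∩ T')) * #(linExts x (S ∩ S') (T ∪ T')) := by
  set n := Fintype.card β
  have hlim := tendsto_pow_sub_descFactorial_div n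
  have hlim' := (hlim.const_add (#(linExts x (S ∪ S') (T ∩ T')) : ℝ)).mul
    (hlim.const_add (#(linExts x (S ∩ S') (T ∪ T')) : ℝ))
  rw [add_zero, add_zero] at hlim'
  have : ((#(linExts x S T) * #(linExts x S' T') : ℕ) : ℝ) ≤
      #(linExts x (S ∪ S') (T ∩ T')) * #(linExts x (S ∩ S') (T ∪ T')) := by
    refine ge_of_tendsto hlim' ?_
    filter_upwards [Filter.eventually_ge_atTop n] with N hN
    have hO : (0 : ℝ) < Fintype.card (Fin n ↪o Fin N) := by
      exact_mod_cast Fintype.card_pos_iff.2 ⟨Fin.castLEOrderEmb hN⟩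
    have h := (Nat.mul_le_mul (card_linExts_mul_le_card_orderMaps (x := x) S T N)
      (card_linExts_mul_le_card_orderMaps (x := x) S' T' N)).trans
      ((card_orderMaps_mul_le S T S' T' N).trans
        (Nat.mul_le_mul (card_orderMaps_le _ _ N) (card_orderMaps_le _ _ N)))
    have h : ((#(linExts x S T) : ℝ) * Fintype.card (Fin n ↪o Fin N)) *
        (#(linExts x S' T') * Fintype.card (Fin n ↪o Fin N)) ≤
        (#(linExts x (S ∪ S') (T ∩ T')) * Fintype.card (Fin n ↪o Fin N) +
          ((N ^ n - N.descFactorial n : ℕ) : ℝ)) *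
        (#(linExts x (S ∩ S') (T ∪ T')) * Fintype.card (Fin n ↪o Fin N) +
          ((N ^ n - N.descFactorial n : ℕ) : ℝ)) := by
      exact_mod_cast h
    generalize ((N ^ n - N.descFactorial n : ℕ) : ℝ) = R at *
    generalize (Fintype.card (Fin n ↪o Fin N) : ℝ) = O at *
    refine le_of_mul_le_mul_right ?_ (mul_pos hO hO)
    push_cast
    have e : ∀ a b : ℝ, (a + R / O) * (b + R / O) * (O * O) = (a * O + R) * (b * O + R) := by
      intro a b; field_simp
    rw [e]
    linarith
  exact_mod_cast this

/-- The probability that all of `S` and none of `T` precedes `x`. -/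
noncomputable def prob (x : β) (S T : Finset β) : ℝ :=
  (#(linExts x S T) : ℝ) / Nat.card (LinExt β)

theorem linExt_nonempty (β : Type) [Fintype β] [PartialOrder β] : Nonempty (LinExt β) := by
  let _ : Fintype (LinearExtension β) := inferInstanceAs (Fintype β)
  let e := (Fintype.orderIsoFinOfCardEq (LinearExtension β) (k := Fintype.card β) rfl).symm
  exact ⟨⟨e.toEquiv, fun a b hab => e.lt_iff_lt.2
    (lt_of_le_of_ne (toLinearExtension.monotone hab.le) hab.ne)⟩⟩

theorem prob_mul_le (S T S' T' : Finset β) :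
    prob x S T * prob x S' T' ≤ prob x (S ∪ S') (T ∩ T') * prob x (S ∩ S') (T ∪ T') := by
  unfold prob
  rw [div_mul_div_comm, div_mul_div_comm]
  refine div_le_div_of_nonneg_right ?_ (by positivity)
  exact_mod_cast card_linExts_mul_le S T S' T'

theorem prob_nonneg (S T : Finset β) : 0 ≤ prob x S T := by unfold prob; positivity

theorem prob_le_one (S T : Finset β) : prob x S T ≤ 1 := by
  refine div_le_one_of_le₀ ?_ (by positivity)
  rw [Nat.card_eq_fintype_card]
  exact_mod_cast card_le_univ _

theorem prob_empty : prob x ∅ ∅ = 1 := by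
  have := linExt_nonempty β
  simp [prob, linExts, Nat.card_eq_fintype_card]

theorem prob_mul_le_union_right (S T S' T' : Finset β) (h : S ∩ S' = S) :
    prob x S T * prob x S' T' ≤ prob x S (T ∪ T') := by
  refine (prob_mul_le S T S' T').trans ?_
  rw [h]
  exact mul_le_of_le_one_left (prob_nonneg _ _) (prob_le_one _ _)

theorem prob_mul_le_union_left (S T S' T' : Finset β) (h : T ∩ T' = T) :
    prob x S T * prob x S' T' ≤ prob x (S ∪ S') T := by
  refine (prob_mul_le S T S' T').trans ?_
  rw [h]
  exact mul_le_of_le_one_right (prob_nonneg _ _) (prob_le_one _ _)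

theorem pow_le_prob_right {c : ℝ} (hc : 0 ≤ c) {k : ℕ} {S : Finset β}
    (hS : c ^ k ≤ prob x S ∅) (T : Finset β) (hT : ∀ y ∈ T, c ≤ prob x S {y}) :
    c ^ (k + #T) ≤ prob x S T := by
  induction T using Finset.induction_on with
  | empty => simpa using hS
  | insert y T hy ih =>
    have h1 := ih fun z hz => hT z (mem_insert_of_mem hz)
    have h2 := hT y (mem_insert_self y T)
    rw [card_insert_of_notMem hy, ← add_assoc, pow_succ, insert_eq, union_comm]
    exact (mul_le_mul h1 h2 hc (prob_nonneg _ _)).trans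
      (prob_mul_le_union_right _ _ _ _ (inter_self S))

theorem pow_le_prob_left {c : ℝ} (hc : 0 ≤ c) {k m : ℕ} {T : Finset β}
    (hT : c ^ k ≤ prob x ∅ T) (S : Finset β) (hS : ∀ z ∈ S, c ^ m ≤ prob x {z} T) :
    c ^ (k + #S * m) ≤ prob x S T := by
  induction S using Finset.induction_on with
  | empty => simpa using hT
  | insert y S hy ih =>
    have h1 := ih fun z hz => hS z (mem_insert_of_mem hz)
    have h2 := hS y (mem_insert_self y S)
    rw [card_insert_of_notMem hy, add_one_mul, ← add_assoc, pow_add, insert_eq, union_comm]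
    exact (mul_le_mul h1 h2 (pow_nonneg hc m) (prob_nonneg _ _)).trans
      (prob_mul_le_union_left _ _ _ _ (inter_self T))

theorem pow_le_prob {c : ℝ} (hc : 0 ≤ c) (S T : Finset β)
    (hS : ∀ z ∈ S, c ≤ prob x {z} ∅) (hT : ∀ y ∈ T, c ≤ prob x ∅ {y})
    (hST : ∀ z ∈ S, ∀ y ∈ T, c ≤ prob x {z} {y}) :
    c ^ (#T + #S * (1 + #T)) ≤ prob x S T := by
  refine pow_le_prob_left hc ?_ S fun z hz =>
    pow_le_prob_right hc (by simpa using hS z hz) T (hST z hz)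
  simpa using pow_le_prob_right (k := 0) hc (by simp [prob_empty]) T hT

theorem Pr_eq (E : LinExt β → Prop) :
    Pr E = (#(univ.filter E) : ℝ) / Nat.card (LinExt β) := by
  rw [Pr, Nat.card_eq_fintype_card (α := {f : LinExt β // E f}), Fintype.card_subtype]

theorem prob_singleton_left (y : β) : prob x {y} ∅ = prLT y x := by
  rw [prLT, Pr_eq, prob]
  congr 3
  ext f
  simp [linExts, _root_.val]

theorem prob_singleton_right {y : β} (hy : y ≠ x) : prob x ∅ {y} = prLT x y := by
  rw [prLT, Pr_eq, prob]
  congr 3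
  ext f
  simp [linExts, _root_.val, lt_iff_le_and_ne, hy.symm, Fin.val_inj]

theorem prob_add_prob_le (z y : β) :
    prob x {z} ∅ + prob x ∅ {y} ≤ 1 + prob x {z} {y} := by
  have := linExt_nonempty β
  have hpos : (0 : ℝ) < Fintype.card (LinExt β) := by exact_mod_cast Fintype.card_pos
  have hinter : linExts x {z} ∅ ∩ linExts x ∅ {y} = linExts x {z} {y} := by
    ext f; simp [linExts]
  have h := card_union_add_card_inter (linExts x {z} ∅) (linExts x ∅ {y})
  rw [hinter] at h
  have h' : #(linExts x {z} ∅) + #(linExts x ∅ {y}) ≤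
      Fintype.card (LinExt β) + #(linExts x {z} {y}) := by
    have := card_le_univ (linExts x {z} ∅ ∪ linExts x ∅ {y}); omega
  unfold prob
  rw [Nat.card_eq_fintype_card, ← add_div, ← div_self hpos.ne', ← add_div]
  exact div_le_div_of_nonneg_right (by exact_mod_cast h') hpos.le

theorem prLT_add_prLT {y : β} (hy : y ≠ x) : prLT y x + prLT x y = 1 := by
  have := linExt_nonempty β
  have hpos : (0 : ℝ) < Fintype.card (LinExt β) := by exact_mod_cast Fintype.card_pos
  have h := card_filter_add_card_filter_not (s := (univ : Finset (LinExt β)))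
    (fun f => val f y < val f x)
  have h' : (univ.filter fun f : LinExt β => ¬ val f y < val f x) =
      univ.filter fun f => val f x < val f y := by
    ext f
    have : f.1 x ≠ f.1 y := fun h => hy (f.1.injective h.symm)
    have : (f.1 x : ℕ) ≠ f.1 y := fun h => this (Fin.ext h)
    rw [mem_filter, mem_filter]
    simp only [mem_univ, true_and, _root_.val]
    omega
  rw [h', card_univ] at h
  rw [prLT, prLT, Pr_eq, Pr_eq, ← add_div, Nat.card_eq_fintype_card, div_eq_one_iff_eq hpos.ne']
  rw [← Nat.cast_add]
  congr 1
  convert h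

theorem prob_le_qVal {S T Z : Finset β} (hxZ : x ∉ Z) (hS : ∀ z ∈ Z, ∃ s ∈ S, z ≤ s)
    (hT : ∀ y ∉ Z, y = x ∨ ∃ t ∈ T, t ≤ y) : prob x S T ≤ qVal x := by
  have hlt : #Z < Fintype.card β := card_lt_univ_of_notMem hxZ
  have hmono (f : LinExt β) {a b : β} (hab : a ≤ b) : f.1 a ≤ f.1 b := by
    rcases hab.eq_or_lt with rfl | h
    · exact le_rfl
    · exact (f.2 a b h).le
  refine le_trans ?_ (le_ciSup (Set.finite_range _).bddAbove ⟨#Z, hlt⟩)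
  rw [Pr_eq, prob]
  refine div_le_div_of_nonneg_right ?_ (by positivity)
  refine Nat.cast_le.2 (card_le_card fun f hf => ?_)
  simp only [linExts, mem_filter, mem_univ, true_and] at hf
  have hZ : Z.map f.1.toEmbedding = Iio (f.1 x) := by
    ext i
    obtain ⟨y, rfl⟩ := f.1.surjective i
    rw [mem_map_equiv, Equiv.symm_apply_apply, mem_Iio]
    constructor
    · intro hy
      obtain ⟨s, hs, hys⟩ := hS y hy
      exact (hmono f hys).trans_lt (hf.1 s hs)
    · intro hy
      by_contra hyZ
      rcases hT y hyZ with rfl | ⟨t, ht, hty⟩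
      · exact lt_irrefl _ hy
      · exact absurd ((hf.2 t ht).trans (hmono f hty)) (not_le.2 hy)
  have hcard : #Z = (f.1 x : ℕ) := by rw [← card_map f.1.toEmbedding, hZ, Fin.card_Iio]
  simp [_root_.val, hcard]

theorem pow_le_qVal {w : ℕ} {ε : ℝ} (hε : 0 < ε)
    (hw : ∀ A : Finset β, IsAntichain (· ≤ ·) (A : Set β) → #A ≤ w)
    (h : ∀ y : β, y ≠ x → min (prLT x y) (prLT y x) ≤ 1 / 2 - ε) :
    min (2 * ε) 1 ^ (w + w * (1 + w)) ≤ qVal x := by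
  set c := min (2 * ε) 1
  have hc : 0 ≤ c := by positivity
  have hcε : c ≤ 2 * ε := min_le_left _ _
  have hc1 : c ≤ 1 := min_le_right _ _
  have hchalf : c ≤ 1 / 2 + ε := by linarith
  let Z : Finset β := univ.filter fun y => y ≠ x ∧ 1 / 2 + ε ≤ prLT y x
  let Y : Finset β := univ.filter fun y => y ≠ x ∧ 1 / 2 + ε ≤ prLT x y
  let S : Finset β := univ.filter (Maximal (· ∈ Z))
  let T : Finset β := univ.filter (Minimal (· ∈ Y))
  have hSZ : ∀ z ∈ S, z ≠ x ∧ 1 / 2 + ε ≤ prLT z x := fun z hz =>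
    (mem_filter.1 (mem_filter.1 hz).2.1).2
  have hTY : ∀ y ∈ T, y ≠ x ∧ 1 / 2 + ε ≤ prLT x y := fun y hy =>
    (mem_filter.1 (mem_filter.1 hy).2.1).2
  have hSw : #S ≤ w := hw S (by simpa [S] using setOfPred_maximal_antichain (· ∈ Z))
  have hTw : #T ≤ w := hw T (by simpa [T] using setOfPred_minimal_antichain (· ∈ Y))
  have hprob : c ^ (#T + #S * (1 + #T)) ≤ prob x S T := by
    refine pow_le_prob hc S T (fun z hz => ?_) (fun y hy => ?_) fun z hz y hy => ?_
    · rw [prob_singleton_left]; linarith [(hSZ z hz).2]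
    · rw [prob_singleton_right (hTY y hy).1]; linarith [(hTY y hy).2]
    · have := prob_add_prob_le (x := x) z y
      rw [prob_singleton_left, prob_singleton_right (hTY y hy).1] at this
      linarith [(hSZ z hz).2, (hTY y hy).2]
  refine (pow_le_pow_of_le_one hc hc1 ?_).trans (hprob.trans (prob_le_qVal (Z := Z) ?_ ?_ ?_))
  · gcongr
  · simp [Z]
  · intro z hz
    obtain ⟨s, hzs, hs⟩ := Z.exists_le_maximal hz
    exact ⟨s, by simpa [S] using hs, hzs⟩
  · intro y hy
    by_cases hyx : y = x
    · exact Or.inl hyx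
    · have hsum := prLT_add_prLT hyx
      have hyZ : ¬ 1 / 2 + ε ≤ prLT y x := fun hle => hy (mem_filter.2 ⟨mem_univ _, hyx, hle⟩)
      have hyY : y ∈ Y := by
        refine mem_filter.2 ⟨mem_univ _, hyx, ?_⟩
        rcases min_le_iff.1 (h y hyx) with h | h <;> linarith
      obtain ⟨t, hty, ht⟩ := Y.exists_le_minimal hyY
      exact Or.inr ⟨t, by simpa [T] using ht, hty⟩

end

/-- for fixed width bound `w` and `ε > 0` there is `δ₀ > 0` such that for every
finite poset of width at most `w` and every `x` with `q(x) ≤ δ₀`, one has `δ_x > 1/2 - ε`. -/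
theorem stmt_11 (w : ℕ) (hw : 1 ≤ w) (ε : ℝ) (hε : 0 < ε) :
    ∃ δ₀ : ℝ, 0 < δ₀ ∧
      ∀ (β : Type) [Fintype β] [PartialOrder β],
        (∀ A : Finset β, IsAntichain (· ≤ ·) (A : Set β) → A.card ≤ w) →
        ∀ x : β, qVal x ≤ δ₀ →
          ∃ y : β, y ≠ x ∧ 1 / 2 - ε < min (prLT x y) (prLT y x) := by
  have hpos : 0 < min (2 * ε) 1 ^ (w + w * (1 + w)) := by positivity
  refine ⟨_, half_pos hpos, fun β _ _ hwidth x hq => ?_⟩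
  by_contra! h
  linarith [pow_le_qVal hε hwidth h]
end
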